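/- Let b > 0 and R > 0, and let u ∈ E_R be a minimizer of G_{b,K_R} over E_R, i.e. G_{b,K_R}(u) = m_p(b,R). Then: (1) u is a solution of the equation −b(∇ − iA₀)²u = (1 − |u|²)u in all of ℝ², where (∇ − iA₀)² denotes the magnetic Laplacian Σ_{j=1,2}(∂_j − i(A₀)_j)²; and (2) there exists a universal constant C_max > 0 (independent of b, R and u) such that ‖u‖_{L∞(ℝ²)} ≤ min(1, C_max ([1/b − 1]_+)^{1/2}). -/

import Mathlib

open MeasureTheory Filter Set

noncomputable section

/-- The canonical 2D magnetic potential `A₀(x) = (-x₂/2, x₁/2)`. -/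
def A0 (x : ℝ × ℝ) : ℝ × ℝ := (-x.2 / 2, x.1 / 2)

/-- The open square `K_R = (-R/2, R/2) × (-R/2, R/2)` in `ℝ²`. -/
def KR (R : ℝ) : Set (ℝ × ℝ) := Ioo (-R/2) (R/2) ×ˢ Ioo (-R/2) (R/2)

/-- First component of the magnetic gradient `(∇ - iA₀)u`. -/
def D1 (u : ℝ × ℝ → ℂ) (x : ℝ × ℝ) : ℂ :=
  fderiv ℝ u x (1, 0) - Complex.I * ((A0 x).1 : ℂ) * u x

/-- Second component of the magnetic gradient `(∇ - iA₀)u`. -/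
def D2 (u : ℝ × ℝ → ℂ) (x : ℝ × ℝ) : ℂ :=
  fderiv ℝ u x (0, 1) - Complex.I * ((A0 x).2 : ℂ) * u x

/-- The two-dimensional Ginzburg–Landau energy `G_{b,K_R}(u)`. -/
def G2 (b R : ℝ) (u : ℝ × ℝ → ℂ) : ℝ :=
  ∫ x in KR R, (b * (‖D1 u x‖ ^ 2 + ‖D2 u x‖ ^ 2) - ‖u x‖ ^ 2 + (1/2) * ‖u x‖ ^ 4)

/-- `m₀(b,R)`: the ground state energy of `G_{b,K_R}` with Dirichlet boundary conditions,
realized (by density) as the infimum over smooth functions compactly supported in `K_R`. -/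
def m0 (b R : ℝ) : ℝ :=
  sInf {E : ℝ | ∃ u : ℝ × ℝ → ℂ, ContDiff ℝ (⊤ : ℕ∞) u ∧ HasCompactSupport u ∧
    tsupport u ⊆ KR R ∧ E = G2 b R u}

/-- The magnetic periodicity conditions defining the space `E_R`. -/
def MagPeriodic (R : ℝ) (u : ℝ × ℝ → ℂ) : Prop :=
  ∀ x : ℝ × ℝ,
    u (x.1 + R, x.2) = Complex.exp (Complex.I * (R * x.2 / 2)) * u x ∧
    u (x.1, x.2 + R) = Complex.exp (-(Complex.I * (R * x.1 / 2))) * u x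

/-- `m_p(b,R)`: the ground state energy of `G_{b,K_R}` over the magnetically periodic space
`E_R`, realized (by elliptic regularity/density) over smooth magnetic periodic functions. -/
def mp (b R : ℝ) : ℝ :=
  sInf {E : ℝ | ∃ u : ℝ × ℝ → ℂ, ContDiff ℝ (⊤ : ℕ∞) u ∧ MagPeriodic R u ∧ E = G2 b R u}

/-- The lowest Landau band equation `(∂₁ + i∂₂ + (1/2)(x₁ + ix₂))u = 0`. -/
def LLL (u : ℝ × ℝ → ℂ) : Prop :=
  ∀ x : ℝ × ℝ,
    fderiv ℝ u x (1, 0) + Complex.I * fderiv ℝ u x (0, 1)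
      + (1/2 : ℂ) * ((x.1 : ℂ) + Complex.I * (x.2 : ℂ)) * u x = 0

/-- The Abrikosov energy `F_R(v) = ∫_{K_R} (-|v|² + (1/2)|v|⁴)`. -/
def FAb (R : ℝ) (v : ℝ × ℝ → ℂ) : ℝ :=
  ∫ x in KR R, (-‖v x‖ ^ 2 + (1/2) * ‖v x‖ ^ 4)

/-- `c(R)`: the minimal Abrikosov energy over the lowest Landau band `L_R`. -/
def cAb (R : ℝ) : ℝ :=
  sInf {E : ℝ | ∃ u : ℝ × ℝ → ℂ, ContDiff ℝ (⊤ : ℕ∞) u ∧ MagPeriodic R u ∧ LLL u ∧ E = FAb R u}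

/-- The thermodynamic limit function `g(b) = lim_{R→∞} m₀(b,R)/R²`. -/
def gfun (b : ℝ) : ℝ := limUnder atTop (fun R : ℝ => m0 b R / R ^ 2)

/-- The canonical 3D magnetic potential `F(x) = (-x₂/2, x₁/2, 0)`. -/
def Fpot (x : ℝ × ℝ × ℝ) : ℝ × ℝ × ℝ := (-x.2.1 / 2, x.1 / 2, 0)

/-- The open cube `Q_R = (-R/2, R/2)³` in `ℝ³`. -/
def QR (R : ℝ) : Set (ℝ × ℝ × ℝ) :=
  Ioo (-R/2) (R/2) ×ˢ Ioo (-R/2) (R/2) ×ˢ Ioo (-R/2) (R/2)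

/-- First component of the 3D magnetic gradient `(∇ - iF)u`. -/
def DD1 (u : ℝ × ℝ × ℝ → ℂ) (x : ℝ × ℝ × ℝ) : ℂ :=
  fderiv ℝ u x (1, 0, 0) - Complex.I * ((Fpot x).1 : ℂ) * u x

/-- Second component of the 3D magnetic gradient `(∇ - iF)u`. -/
def DD2 (u : ℝ × ℝ × ℝ → ℂ) (x : ℝ × ℝ × ℝ) : ℂ :=
  fderiv ℝ u x (0, 1, 0) - Complex.I * ((Fpot x).2.1 : ℂ) * u x

/-- Third component of the 3D magnetic gradient `(∇ - iF)u`. -/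
def DD3 (u : ℝ × ℝ × ℝ → ℂ) (x : ℝ × ℝ × ℝ) : ℂ :=
  fderiv ℝ u x (0, 0, 1) - Complex.I * ((Fpot x).2.2 : ℂ) * u x

/-- The three-dimensional Ginzburg–Landau energy `F³ᴰ_{b,Q_R}(u)`. -/
def G3 (b R : ℝ) (u : ℝ × ℝ × ℝ → ℂ) : ℝ :=
  ∫ x in QR R, (b * (‖DD1 u x‖ ^ 2 + ‖DD2 u x‖ ^ 2 + ‖DD3 u x‖ ^ 2)
    - ‖u x‖ ^ 2 + (1/2) * ‖u x‖ ^ 4)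

/-- `M₀(b,R)`: the 3D ground state energy with Dirichlet boundary conditions. -/
def M0 (b R : ℝ) : ℝ :=
  sInf {E : ℝ | ∃ u : ℝ × ℝ × ℝ → ℂ, ContDiff ℝ (⊤ : ℕ∞) u ∧ HasCompactSupport u ∧
    tsupport u ⊆ QR R ∧ E = G3 b R u}

end


/-- The real inner product of two complex numbers. -/
def dot (z w : ℂ) : ℝ := z.re * w.re + z.im * w.im

/-- Invariance under the lattice of translations generated by `(R, 0)` and `(0, R)`. -/
def DoublyPeriodic {α : Type*} (R : ℝ) (h : ℝ × ℝ → α) : Prop :=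
  ∀ x : ℝ × ℝ, h (x.1 + R, x.2) = h x ∧ h (x.1, x.2 + R) = h x

lemma dot_self (z : ℂ) : dot z z = ‖z‖ ^ 2 := by
  rw [← Complex.normSq_eq_norm_sq, Complex.normSq_apply, dot]

lemma dot_comm (z w : ℂ) : dot z w = dot w z := by
  simp only [dot]; ring

lemma abs_dot_le (z w : ℂ) : |dot z w| ≤ ‖z‖ * ‖w‖ := by
  apply abs_le_of_sq_le_sq _ (by positivity)
  rw [mul_pow, ← dot_self, ← dot_self]
  simp only [dot]
  nlinarith [sq_nonneg (z.re * w.im - z.im * w.re)]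

lemma dot_eq_inner (z w : ℂ) : dot z w = inner ℝ z w := by
  simp [dot, Complex.inner]; ring

lemma ContDiff.dot {f g : ℝ × ℝ → ℂ} {n : WithTop ℕ∞} (hf : ContDiff ℝ n f)
    (hg : ContDiff ℝ n g) : ContDiff ℝ n (fun x => dot (f x) (g x)) := by
  simp only [dot_eq_inner]
  exact hf.inner ℝ hg

lemma fderiv_dot_D1 {f g : ℝ × ℝ → ℂ} (hf : Differentiable ℝ f) (hg : Differentiable ℝ g)
    (x : ℝ × ℝ) :
    fderiv ℝ (fun y => dot (f y) (g y)) x (1, 0) = dot (D1 f x) (g x) + dot (f x) (D1 g x) := by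
  simp only [dot_eq_inner]
  rw [fderiv_inner_apply ℝ (hf x) (hg x)]
  simp only [← dot_eq_inner, dot, D1]
  simp
  ring

lemma fderiv_dot_D2 {f g : ℝ × ℝ → ℂ} (hf : Differentiable ℝ f) (hg : Differentiable ℝ g)
    (x : ℝ × ℝ) :
    fderiv ℝ (fun y => dot (f y) (g y)) x (0, 1) = dot (D2 f x) (g x) + dot (f x) (D2 g x) := by
  simp only [dot_eq_inner]
  rw [fderiv_inner_apply ℝ (hf x) (hg x)]
  simp only [← dot_eq_inner, dot, D2]
  simp
  ring

lemma ContDiff.fderiv_apply_const {F : Type*} [NormedAddCommGroup F] [NormedSpace ℝ F]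
    {f : ℝ × ℝ → F} (hf : ContDiff ℝ (⊤ : ℕ∞) f)
    (e : ℝ × ℝ) : ContDiff ℝ (⊤ : ℕ∞) (fun x => fderiv ℝ f x e) :=
  (hf.fderiv_right (m := (⊤ : ℕ∞)) (by simp)).clm_apply contDiff_const

lemma ContDiff.D1 {f : ℝ × ℝ → ℂ} (hf : ContDiff ℝ (⊤ : ℕ∞) f) :
    ContDiff ℝ (⊤ : ℕ∞) (D1 f) := by
  have hA : ContDiff ℝ (⊤ : ℕ∞) (fun x : ℝ × ℝ => (A0 x).1) := by
    simp only [A0]; fun_prop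
  have h : ContDiff ℝ (⊤ : ℕ∞) (fun x : ℝ × ℝ => ((A0 x).1 : ℂ)) :=
    Complex.ofRealCLM.contDiff.comp hA
  exact (hf.fderiv_apply_const _).sub ((contDiff_const.mul h).mul hf)

lemma ContDiff.D2 {f : ℝ × ℝ → ℂ} (hf : ContDiff ℝ (⊤ : ℕ∞) f) :
    ContDiff ℝ (⊤ : ℕ∞) (D2 f) := by
  have hA : ContDiff ℝ (⊤ : ℕ∞) (fun x : ℝ × ℝ => (A0 x).2) := by
    simp only [A0]; fun_prop
  have h : ContDiff ℝ (⊤ : ℕ∞) (fun x : ℝ × ℝ => ((A0 x).2 : ℂ)) :=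
    Complex.ofRealCLM.contDiff.comp hA
  exact (hf.fderiv_apply_const _).sub ((contDiff_const.mul h).mul hf)

lemma D1_add_const_mul {f g : ℝ × ℝ → ℂ} (hf : Differentiable ℝ f) (hg : Differentiable ℝ g)
    (c : ℂ) (x : ℝ × ℝ) : D1 (fun y => f y + c * g y) x = D1 f x + c * D1 g x := by
  simp only [D1]
  rw [fderiv_fun_add (hf x) ((hg x).const_mul c), fderiv_const_mul (hg x)]
  simp
  ring

lemma D2_add_const_mul {f g : ℝ × ℝ → ℂ} (hf : Differentiable ℝ f) (hg : Differentiable ℝ g)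
    (c : ℂ) (x : ℝ × ℝ) : D2 (fun y => f y + c * g y) x = D2 f x + c * D2 g x := by
  simp only [D2]
  rw [fderiv_fun_add (hf x) ((hg x).const_mul c), fderiv_const_mul (hg x)]
  simp
  ring

lemma fderiv_ofReal_mul {k : ℝ × ℝ → ℝ} {f : ℝ × ℝ → ℂ} (hk : Differentiable ℝ k)
    (hf : Differentiable ℝ f) (x e : ℝ × ℝ) :
    fderiv ℝ (fun y => (k y : ℂ) * f y) x e
      = (k x : ℂ) * fderiv ℝ f x e + (fderiv ℝ k x e : ℂ) * f x := by
  have h := ((hk x).hasFDerivAt.smul (hf x).hasFDerivAt).fderiv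
  have h2 : (fun y => (k y : ℂ) * f y) = k • f := by
    ext y; simp
  rw [h2, h]
  simp

lemma D1_ofReal_mul {k : ℝ × ℝ → ℝ} {f : ℝ × ℝ → ℂ} (hk : Differentiable ℝ k)
    (hf : Differentiable ℝ f) (x : ℝ × ℝ) :
    D1 (fun y => (k y : ℂ) * f y) x
      = (k x : ℂ) * D1 f x + (fderiv ℝ k x (1, 0) : ℂ) * f x := by
  simp only [D1, fderiv_ofReal_mul hk hf]
  ring

lemma D2_ofReal_mul {k : ℝ × ℝ → ℝ} {f : ℝ × ℝ → ℂ} (hk : Differentiable ℝ k)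
    (hf : Differentiable ℝ f) (x : ℝ × ℝ) :
    D2 (fun y => (k y : ℂ) * f y) x
      = (k x : ℂ) * D2 f x + (fderiv ℝ k x (0, 1) : ℂ) * f x := by
  simp only [D2, fderiv_ofReal_mul hk hf]
  ring

/-- The commutation relation of the magnetic derivatives: `[D₁, D₂] = -i`. -/
lemma D1_D2_eq {f : ℝ × ℝ → ℂ} (hf : ContDiff ℝ (⊤ : ℕ∞) f) (x : ℝ × ℝ) :
    D1 (D2 f) x = D2 (D1 f) x - Complex.I * f x := by
  have hd : Differentiable ℝ f := hf.differentiable (by simp)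
  have hd1 : Differentiable ℝ (fun x => fderiv ℝ f x (1, 0)) :=
    (hf.fderiv_apply_const (1, 0)).differentiable (by simp)
  have hd2 : Differentiable ℝ (fun x => fderiv ℝ f x (0, 1)) :=
    (hf.fderiv_apply_const (0, 1)).differentiable (by simp)
  have hdd : DifferentiableAt ℝ (fderiv ℝ f) x :=
    (hf.fderiv_right (m := (⊤ : ℕ∞)) (by simp)).differentiable (by simp) x
  have hsymm : fderiv ℝ (fun y => fderiv ℝ f y (0, 1)) x (1, 0)
      = fderiv ℝ (fun y => fderiv ℝ f y (1, 0)) x (0, 1) := by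
    have := (hf.contDiffAt (x := x))
      |>.isSymmSndFDerivAt (by simpa using ENat.LEInfty.out) (1, 0) (0, 1)
    rw [fderiv_clm_apply hdd (by fun_prop), fderiv_clm_apply hdd (by fun_prop)]
    simpa using this
  have hA1 : HasFDerivAt (fun y : ℝ × ℝ => (A0 y).1)
      ((-1 / 2 : ℝ) • ContinuousLinearMap.snd ℝ ℝ ℝ) x := by
    have h : (fun y : ℝ × ℝ => (A0 y).1) = fun y => (-1 / 2 : ℝ) * y.2 := by
      ext y; simp only [A0]; ring
    rw [h]
    exact hasFDerivAt_snd.const_mul (-1 / 2 : ℝ)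
  have hA2 : HasFDerivAt (fun y : ℝ × ℝ => (A0 y).2)
      ((1 / 2 : ℝ) • ContinuousLinearMap.fst ℝ ℝ ℝ) x := by
    have h : (fun y : ℝ × ℝ => (A0 y).2) = fun y => (1 / 2 : ℝ) * y.1 := by
      ext y; simp only [A0]; ring
    rw [h]
    exact hasFDerivAt_fst.const_mul (1 / 2 : ℝ)
  have e1 : D1 f = fun y => fderiv ℝ f y (1, 0)
      + (-Complex.I) * (((A0 y).1 : ℂ) * f y) := by
    ext y; simp only [D1]; ring
  have e2 : D2 f = fun y => fderiv ℝ f y (0, 1)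
      + (-Complex.I) * (((A0 y).2 : ℂ) * f y) := by
    ext y; simp only [D2]; ring
  have dA1 : Differentiable ℝ (fun y : ℝ × ℝ => (A0 y).1) := by
    simp only [A0]; fun_prop
  have dA2 : Differentiable ℝ (fun y : ℝ × ℝ => (A0 y).2) := by
    simp only [A0]; fun_prop
  have dm1 : Differentiable ℝ (fun y : ℝ × ℝ => ((A0 y).1 : ℂ) * f y) :=
    (Complex.ofRealCLM.differentiable.comp dA1).mul hd
  have dm2 : Differentiable ℝ (fun y : ℝ × ℝ => ((A0 y).2 : ℂ) * f y) :=
    (Complex.ofRealCLM.differentiable.comp dA2).mul hd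
  rw [e1, e2, D1_add_const_mul hd2 dm2, D2_add_const_mul hd1 dm1, D1_ofReal_mul dA2 hd,
    D2_ofReal_mul dA1 hd, hA1.fderiv, hA2.fderiv]
  simp only [D1, D2, hsymm]
  simp [A0]
  ring

lemma dot_mul_of_norm_eq_one {c : ℂ} (hc : ‖c‖ = 1) (z w : ℂ) :
    dot (c * z) (c * w) = dot z w := by
  have h : c.re * c.re + c.im * c.im = 1 := by
    have := dot_self c
    rw [hc] at this
    simpa [dot] using this
  simp only [dot, Complex.mul_re, Complex.mul_im]
  linear_combination (z.re * w.re + z.im * w.im) * h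

namespace MagPeriodic

variable {R : ℝ} {f g : ℝ × ℝ → ℂ}

lemma dot (hf : MagPeriodic R f) (hg : MagPeriodic R g) :
    DoublyPeriodic R (fun x => dot (f x) (g x)) := by
  intro x
  have h1 : ‖Complex.exp (Complex.I * (R * x.2 / 2))‖ = 1 := by
    have := Complex.norm_exp_I_mul_ofReal (R * x.2 / 2)
    simpa using this
  have h2 : ‖Complex.exp (-(Complex.I * (R * x.1 / 2)))‖ = 1 := by
    have := Complex.norm_exp_I_mul_ofReal (-(R * x.1 / 2))
    simpa using this
  constructor
  · show _root_.dot (f _) (g _) = _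
    rw [(hf x).1, (hg x).1, dot_mul_of_norm_eq_one h1]
  · show _root_.dot (f _) (g _) = _
    rw [(hf x).2, (hg x).2, dot_mul_of_norm_eq_one h2]

lemma norm_sq (hf : MagPeriodic R f) : DoublyPeriodic R (fun x => ‖f x‖ ^ 2) := by
  simpa only [dot_self] using hf.dot hf

lemma add_const_mul (hf : MagPeriodic R f) (hg : MagPeriodic R g) (c : ℂ) :
    MagPeriodic R (fun x => f x + c * g x) := by
  intro x
  constructor
  · simp only [(hf x).1, (hg x).1]; ring
  · simp only [(hf x).2, (hg x).2]; ring

lemma ofReal_mul {k : ℝ × ℝ → ℝ} (hk : DoublyPeriodic R k) (hf : MagPeriodic R f) :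
    MagPeriodic R (fun x => (k x : ℂ) * f x) := by
  intro x
  constructor
  · simp only [(hf x).1, (hk x).1]; ring
  · simp only [(hf x).2, (hk x).2]; ring

lemma const_mul (hf : MagPeriodic R f) (c : ℂ) : MagPeriodic R (fun x => c * f x) := by
  intro x
  constructor
  · simp only [(hf x).1]; ring
  · simp only [(hf x).2]; ring

lemma fderiv_of_translate (hf : Differentiable ℝ f) (s : ℝ × ℝ) (l : ℝ × ℝ →L[ℝ] ℝ)
    (h : ∀ y, f (y + s) = Complex.exp (Complex.I * (l y : ℝ)) * f y) (x e : ℝ × ℝ) :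
    fderiv ℝ f (x + s) e
      = Complex.exp (Complex.I * (l x : ℝ)) * (fderiv ℝ f x e + Complex.I * (l e : ℝ) * f x) := by
  have h1 : fderiv ℝ (fun y => f (y + s)) x = fderiv ℝ f (x + s) := fderiv_comp_add_right s
  have h2 : HasFDerivAt (fun y => Complex.I * ((l y : ℝ) : ℂ))
      (Complex.I • (Complex.ofRealCLM.comp l)) x :=
    ((Complex.ofRealCLM.comp l).hasFDerivAt (x := x)).const_mul Complex.I
  have h3 := (h2.cexp.mul (hf x).hasFDerivAt).fderiv
  have h4 : (fun y => f (y + s))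
      = (fun y => Complex.exp (Complex.I * ((l y : ℝ) : ℂ))) * f := by
    ext y; simp [h y]
  rw [← h1, h4, h3]
  simp
  ring

lemma fderiv_translate_fst (hf : Differentiable ℝ f) (hp : MagPeriodic R f) (x e : ℝ × ℝ) :
    fderiv ℝ f (x.1 + R, x.2) e = Complex.exp (Complex.I * (R * x.2 / 2))
      * (fderiv ℝ f x e + Complex.I * (R * e.2 / 2) * f x) := by
  have h := fderiv_of_translate hf (R, 0) ((R / 2) • ContinuousLinearMap.snd ℝ ℝ ℝ)
    (fun y => by
      have := (hp y).1
      rw [show y + (R, 0) = (y.1 + R, y.2) by ext <;> simp, this]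
      congr 3; simp; ring) x e
  rw [show x + (R, 0) = (x.1 + R, x.2) by ext <;> simp] at h
  rw [h]
  have h2 : ∀ y : ℝ × ℝ, ((((R / 2) • ContinuousLinearMap.snd ℝ ℝ ℝ) y : ℝ) : ℂ)
      = R * y.2 / 2 := fun y => by simp; ring
  simp only [h2]

lemma fderiv_translate_snd (hf : Differentiable ℝ f) (hp : MagPeriodic R f) (x e : ℝ × ℝ) :
    fderiv ℝ f (x.1, x.2 + R) e = Complex.exp (-(Complex.I * (R * x.1 / 2)))
      * (fderiv ℝ f x e - Complex.I * (R * e.1 / 2) * f x) := by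
  have h := fderiv_of_translate hf (0, R) ((-R / 2) • ContinuousLinearMap.fst ℝ ℝ ℝ)
    (fun y => by
      have := (hp y).2
      rw [show y + (0, R) = (y.1, y.2 + R) by ext <;> simp, this]
      congr 2; simp; ring) x e
  rw [show x + (0, R) = (x.1, x.2 + R) by ext <;> simp] at h
  rw [h]
  have h2 : ∀ y : ℝ × ℝ, ((((-R / 2) • ContinuousLinearMap.fst ℝ ℝ ℝ) y : ℝ) : ℂ)
      = -(R * y.1 / 2) := fun y => by simp; ring
  simp only [h2]
  rw [mul_neg]
  ring

lemma D1 (hf : Differentiable ℝ f) (hp : MagPeriodic R f) : MagPeriodic R (D1 f) := by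
  intro x
  constructor
  · simp only [_root_.D1, fderiv_translate_fst hf hp, (hp x).1, A0]
    push_cast; ring
  · simp only [_root_.D1, fderiv_translate_snd hf hp, (hp x).2, A0]
    push_cast; ring

lemma D2 (hf : Differentiable ℝ f) (hp : MagPeriodic R f) : MagPeriodic R (D2 f) := by
  intro x
  constructor
  · simp only [_root_.D2, fderiv_translate_fst hf hp, (hp x).1, A0]
    push_cast; ring
  · simp only [_root_.D2, fderiv_translate_snd hf hp, (hp x).2, A0]
    push_cast; ring

/-- A nonzero magnetic periodic function forces the flux `R²` to be a multiple of `2π`. -/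
lemma one_le (hR : 0 < R) (hp : MagPeriodic R f) {x : ℝ × ℝ} (hx : f x ≠ 0) : 1 ≤ R := by
  have h1 := (hp (x.1, x.2 + R)).1
  have h2 := (hp (x.1 + R, x.2)).2
  simp only at h1 h2
  rw [(hp x).2] at h1
  rw [(hp x).1, h1, ← mul_assoc, ← mul_assoc, ← Complex.exp_add, ← Complex.exp_add] at h2
  have h3 := mul_right_cancel₀ hx h2
  rw [Complex.exp_eq_exp_iff_exists_int] at h3
  obtain ⟨n, hn⟩ := h3
  have h4 : (R : ℂ) ^ 2 = n * (2 * Real.pi) := by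
    apply mul_left_cancel₀ Complex.I_ne_zero
    push_cast at hn
    linear_combination hn
  have h5 : R ^ 2 = n * (2 * Real.pi) := by exact_mod_cast h4
  have hpi := Real.pi_gt_three
  have hn1 : (1 : ℝ) ≤ n := by
    have : 0 < n := by
      by_contra hcon
      have : (n : ℝ) ≤ 0 := by exact_mod_cast not_lt.mp hcon
      nlinarith [sq_pos_of_pos hR]
    exact_mod_cast this
  nlinarith

end MagPeriodic

namespace DoublyPeriodic

variable {R : ℝ}

lemma exists_mem_Icc {α : Type*} {h : ℝ × ℝ → α} (hh : DoublyPeriodic R h) (hR : 0 < R)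
    (p x : ℝ × ℝ) : ∃ y ∈ Icc p (p + (R, R)), h x = h y := by
  have h1 : Function.Periodic (fun t => h (t, x.2)) R := fun t => (hh (t, x.2)).1
  obtain ⟨a, ha, hxa⟩ := h1.exists_mem_Ico hR x.1 p.1
  have h2 : Function.Periodic (fun t => h (a, t)) R := fun t => (hh (a, t)).2
  obtain ⟨c, hc, hxc⟩ := h2.exists_mem_Ico hR x.2 p.2
  exact ⟨(a, c), ⟨⟨ha.1, hc.1⟩, ⟨ha.2.le, hc.2.le⟩⟩, hxa.trans hxc⟩

lemma exists_forall_le {h : ℝ × ℝ → ℝ} (hh : DoublyPeriodic R h) (hR : 0 < R)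
    (hc : Continuous h) : ∃ x, ∀ y, h y ≤ h x := by
  have hne : (Icc (0 : ℝ × ℝ) (0 + (R, R))).Nonempty :=
    nonempty_Icc.mpr ⟨by simpa using hR.le, by simpa using hR.le⟩
  obtain ⟨x, -, hx⟩ := isCompact_Icc.exists_isMaxOn hne hc.continuousOn
  refine ⟨x, fun y => ?_⟩
  obtain ⟨z, hz, hyz⟩ := hh.exists_mem_Icc hR 0 y
  rw [hyz]
  exact hx hz

lemma mul {h k : ℝ × ℝ → ℝ} (hh : DoublyPeriodic R h) (hk : DoublyPeriodic R k) :
    DoublyPeriodic R (fun x => h x * k x) := by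
  intro x
  constructor
  · simp only [(hh x).1, (hk x).1]
  · simp only [(hh x).2, (hk x).2]

/-- Divergence theorem on the torus. -/
lemma setIntegral_div_eq_zero {F G : ℝ × ℝ → ℝ} (hR : 0 < R)
    (hF : ContDiff ℝ (⊤ : ℕ∞) F) (hG : ContDiff ℝ (⊤ : ℕ∞) G)
    (pF : DoublyPeriodic R F) (pG : DoublyPeriodic R G) (p : ℝ × ℝ) :
    ∫ x in Icc p (p + (R, R)), (fderiv ℝ F x (1, 0) + fderiv ℝ G x (0, 1)) = 0 := by
  rw [integral_divergence_prod_Icc_of_hasFDerivAt_of_le F G (fderiv ℝ F) (fderiv ℝ G) p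
    (p + (R, R)) ⟨by simpa using hR.le, by simpa using hR.le⟩ hF.continuous.continuousOn
    hG.continuous.continuousOn (fun x _ => (hF.differentiable (by simp) x).hasFDerivAt)
    (fun x _ => (hG.differentiable (by simp) x).hasFDerivAt)
    ((hF.fderiv_apply_const _).continuous.add
      (hG.fderiv_apply_const _).continuous).continuousOn.integrableOn_Icc]
  have h1 : ∀ t, G (t, (p + (R, R)).2) = G (t, p.2) := fun t => (pG (t, p.2)).2
  have h2 : ∀ t, F ((p + (R, R)).1, t) = F (p.1, t) := fun t => (pF (p.1, t)).1
  simp only [h1, h2]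
  ring

/-- Weighted integration by parts on the torus. -/
lemma setIntegral_mul_div {w F G : ℝ × ℝ → ℝ} (hR : 0 < R)
    (hw : ContDiff ℝ (⊤ : ℕ∞) w)
    (hF : ContDiff ℝ (⊤ : ℕ∞) F) (hG : ContDiff ℝ (⊤ : ℕ∞) G)
    (pw : DoublyPeriodic R w)
    (pF : DoublyPeriodic R F) (pG : DoublyPeriodic R G) (p : ℝ × ℝ) :
    ∫ x in Icc p (p + (R, R)), (w x * (fderiv ℝ F x (1, 0) + fderiv ℝ G x (0, 1))
      + (fderiv ℝ w x (1, 0) * F x + fderiv ℝ w x (0, 1) * G x)) = 0 := by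
  refine Eq.trans ?_
    (setIntegral_div_eq_zero hR (hw.mul hF) (hw.mul hG) (pw.mul pF) (pw.mul pG) p)
  congr 1 with x
  have h1 : fderiv ℝ (fun x => w x * F x) x = _ :=
    fderiv_fun_mul (hw.differentiable (by simp) x) (hF.differentiable (by simp) x)
  have h2 : fderiv ℝ (fun x => w x * G x) x = _ :=
    fderiv_fun_mul (hw.differentiable (by simp) x) (hG.differentiable (by simp) x)
  rw [h1, h2]
  simp
  ring

/-- A continuous nonnegative periodic function with vanishing integral over a period vanishes. -/
lemma eq_zero_of_setIntegral_eq_zero {h : ℝ × ℝ → ℝ} (hh : DoublyPeriodic R h) (hR : 0 < R)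
    (hc : Continuous h) (h0 : ∀ x, 0 ≤ h x) (p : ℝ × ℝ)
    (hi : ∫ x in Icc p (p + (R, R)), h x = 0) (x : ℝ × ℝ) : h x = 0 := by
  have hae := (setIntegral_eq_zero_iff_of_nonneg_ae (ae_of_all _ h0)
    hc.continuousOn.integrableOn_Icc).mp hi
  have hcl : Icc p (p + (R, R)) ⊆ closure (interior (Icc p (p + (R, R)))) := by
    rw [← Icc_prod_Icc, interior_prod_eq, closure_prod_eq, interior_Icc, interior_Icc,
      closure_Ioo, closure_Ioo]
    · simpa using hR.ne'
    · simpa using hR.ne'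
  have heq := Measure.eqOn_of_ae_eq hae hc.continuousOn continuousOn_const hcl
  obtain ⟨y, hy, hxy⟩ := hh.exists_mem_Icc hR p x
  rw [hxy]
  exact heq hy

end DoublyPeriodic

lemma KR_ae_eq (R : ℝ) :
    KR R =ᵐ[volume] Icc ((-R / 2, -R / 2) : ℝ × ℝ) ((-R / 2, -R / 2) + (R, R)) := by
  have h : ((-R / 2, -R / 2) : ℝ × ℝ) + (R, R) = (R / 2, R / 2) := by
    ext <;> simp <;> ring
  rw [h, ← Icc_prod_Icc]
  exact Measure.set_prod_ae_eq Ioo_ae_eq_Icc Ioo_ae_eq_Icc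

/-- The Ginzburg–Landau energy density. -/
noncomputable def glDensity (b : ℝ) (u : ℝ × ℝ → ℂ) (x : ℝ × ℝ) : ℝ :=
  b * (‖D1 u x‖ ^ 2 + ‖D2 u x‖ ^ 2) - ‖u x‖ ^ 2 + (1 / 2) * ‖u x‖ ^ 4

lemma G2_eq (b R : ℝ) (u : ℝ × ℝ → ℂ) :
    G2 b R u = ∫ x in Icc ((-R / 2, -R / 2) : ℝ × ℝ) ((-R / 2, -R / 2) + (R, R)),
      glDensity b u x :=
  setIntegral_congr_set (KR_ae_eq R)

lemma continuous_glDensity (b : ℝ) {u : ℝ × ℝ → ℂ} (hu : ContDiff ℝ (⊤ : ℕ∞) u) :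
    Continuous (glDensity b u) := by
  have h0 := hu.continuous
  have h1 := hu.D1.continuous
  have h2 := hu.D2.continuous
  unfold glDensity
  fun_prop

lemma mp_le {b R : ℝ} (hb : 0 < b) {v : ℝ × ℝ → ℂ} (hv : ContDiff ℝ (⊤ : ℕ∞) v)
    (pv : MagPeriodic R v) : mp b R ≤ G2 b R v := by
  refine csInf_le ⟨∫ x in Icc ((-R / 2, -R / 2) : ℝ × ℝ) ((-R / 2, -R / 2) + (R, R)),
    (-1 / 2 : ℝ), ?_⟩ ⟨v, hv, pv, rfl⟩
  rintro E ⟨f, hf, -, rfl⟩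
  rw [G2_eq]
  refine integral_mono continuous_const.continuousOn.integrableOn_Icc
    (continuous_glDensity b hf).continuousOn.integrableOn_Icc fun x => ?_
  simp only [glDensity]
  have : 0 ≤ b * (‖D1 f x‖ ^ 2 + ‖D2 f x‖ ^ 2) := by positivity
  nlinarith [sq_nonneg (‖f x‖ ^ 2 - 1)]

lemma norm_add_ofReal_mul_sq (z w : ℂ) (t : ℝ) :
    ‖z + t * w‖ ^ 2 = ‖z‖ ^ 2 + 2 * t * dot w z + t ^ 2 * ‖w‖ ^ 2 := by
  simp only [← dot_self, dot]
  simp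
  ring

/-- The first variation of the energy vanishes at a minimizer. -/
lemma setIntegral_first_variation_eq_zero {b R : ℝ} (hb : 0 < b)
    {u v : ℝ × ℝ → ℂ} (hu : ContDiff ℝ (⊤ : ℕ∞) u) (pu : MagPeriodic R u)
    (hv : ContDiff ℝ (⊤ : ℕ∞) v) (pv : MagPeriodic R v) (hmin : G2 b R u = mp b R) :
    ∫ x in Icc ((-R / 2, -R / 2) : ℝ × ℝ) ((-R / 2, -R / 2) + (R, R)),
      (b * (dot (D1 v x) (D1 u x) + dot (D2 v x) (D2 u x))
        - (1 - ‖u x‖ ^ 2) * dot (v x) (u x)) = 0 := by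
  set Q := Icc ((-R / 2, -R / 2) : ℝ × ℝ) ((-R / 2, -R / 2) + (R, R)) with hQ
  have cu := hu.continuous
  have cu1 := hu.D1.continuous
  have cu2 := hu.D2.continuous
  have cv := hv.continuous
  have cv1 := hv.D1.continuous
  have cv2 := hv.D2.continuous
  have c0 := (hv.dot hu).continuous
  have c1 := (hv.D1.dot hu.D1).continuous
  have c2 := (hv.D2.dot hu.D2).continuous
  have int : ∀ {g : ℝ × ℝ → ℝ}, Continuous g → IntegrableOn g Q :=
    fun hg => hg.continuousOn.integrableOn_Icc
  set e1 : ℝ × ℝ → ℝ := fun x => b * (dot (D1 v x) (D1 u x) + dot (D2 v x) (D2 u x))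
        - (1 - ‖u x‖ ^ 2) * dot (v x) (u x) with he1
  set e2 : ℝ × ℝ → ℝ := fun x => b * (‖D1 v x‖ ^ 2 + ‖D2 v x‖ ^ 2) - ‖v x‖ ^ 2
    + ‖u x‖ ^ 2 * ‖v x‖ ^ 2 + 2 * dot (v x) (u x) ^ 2 with he2
  set e3 : ℝ × ℝ → ℝ := fun x => 2 * dot (v x) (u x) * ‖v x‖ ^ 2 with he3
  set e4 : ℝ × ℝ → ℝ := fun x => (1 / 2) * ‖v x‖ ^ 4 with he4
  have ce1 : Continuous e1 := by fun_prop
  have ce2 : Continuous e2 := by fun_prop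
  have ce3 : Continuous e3 := by fun_prop
  have ce4 : Continuous e4 := by fun_prop
  have hexp : ∀ t : ℝ, G2 b R (fun x => u x + (t : ℂ) * v x)
      = G2 b R u + t * (2 * ∫ x in Q, e1 x) + t ^ 2 * (∫ x in Q, e2 x)
        + t ^ 3 * (∫ x in Q, e3 x) + t ^ 4 * (∫ x in Q, e4 x) := by
    intro t
    have hpt : glDensity b (fun x => u x + (t : ℂ) * v x) = fun x =>
        glDensity b u x + t * (2 * e1 x) + t ^ 2 * e2 x + t ^ 3 * e3 x + t ^ 4 * e4 x := by
      ext x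
      simp only [glDensity, he1, he2, he3, he4]
      rw [D1_add_const_mul (hu.differentiable (by simp)) (hv.differentiable (by simp)),
        D2_add_const_mul (hu.differentiable (by simp)) (hv.differentiable (by simp)),
        show ‖u x + (t : ℂ) * v x‖ ^ 4 = (‖u x + (t : ℂ) * v x‖ ^ 2) ^ 2 by ring]
      simp only [norm_add_ofReal_mul_sq]
      ring
    have cg := continuous_glDensity b hu
    rw [G2_eq, G2_eq, hpt, integral_add (int (by fun_prop)) (int (by fun_prop)),
      integral_add (int (by fun_prop)) (int (by fun_prop)),
      integral_add (int (by fun_prop)) (int (by fun_prop)),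
      integral_add (int (by fun_prop)) (int (by fun_prop))]
    simp only [integral_const_mul]
    rfl
  have hder : HasDerivAt (fun t : ℝ => G2 b R u + t * (2 * ∫ x in Q, e1 x)
      + t ^ 2 * (∫ x in Q, e2 x) + t ^ 3 * (∫ x in Q, e3 x) + t ^ 4 * (∫ x in Q, e4 x))
      (2 * ∫ x in Q, e1 x) 0 := by
    have := (((((hasDerivAt_id (0 : ℝ)).mul_const (2 * ∫ x in Q, e1 x)).const_add
      (G2 b R u)).add ((hasDerivAt_pow 2 (0 : ℝ)).mul_const (∫ x in Q, e2 x))).add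
      ((hasDerivAt_pow 3 (0 : ℝ)).mul_const (∫ x in Q, e3 x))).add
      ((hasDerivAt_pow 4 (0 : ℝ)).mul_const (∫ x in Q, e4 x))
    exact this.congr_deriv (by simp)
  have hloc : IsLocalMin (fun t : ℝ => G2 b R u + t * (2 * ∫ x in Q, e1 x)
      + t ^ 2 * (∫ x in Q, e2 x) + t ^ 3 * (∫ x in Q, e3 x) + t ^ 4 * (∫ x in Q, e4 x)) 0 := by
    refine Filter.Eventually.of_forall fun t => ?_
    simp only [← hexp t]
    have := mp_le hb (hu.add (contDiff_const.mul hv)) (pu.add_const_mul pv t)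
    rw [← hmin] at this
    simpa using this
  have := hloc.hasDerivAt_eq_zero hder
  linarith

/-- Minimizers solve the Ginzburg–Landau equation. -/
lemma euler_lagrange {b R : ℝ} (hb : 0 < b) (hR : 0 < R)
    {u : ℝ × ℝ → ℂ} (hu : ContDiff ℝ (⊤ : ℕ∞) u) (pu : MagPeriodic R u)
    (hmin : G2 b R u = mp b R) (x : ℝ × ℝ) :
    -(b : ℂ) * (D1 (D1 u) x + D2 (D2 u) x) = (1 - (‖u x‖ : ℂ) ^ 2) * u x := by
  have hd := hu.differentiable (by simp)
  have hd1 := hu.D1.differentiable (by simp)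
  have hd2 := hu.D2.differentiable (by simp)
  set k : ℝ × ℝ → ℝ := fun y => ‖u y‖ ^ 2 - 1 with hk
  have ck : ContDiff ℝ (⊤ : ℕ∞) k := (hu.norm_sq ℝ).sub contDiff_const
  have pk : DoublyPeriodic R k := fun y => by
    have := pu.norm_sq y
    simp only [hk, this.1, this.2, and_self]
  set r : ℝ × ℝ → ℂ := fun y => ((k y : ℂ) * u y + (-b : ℂ) * D1 (D1 u) y)
    + (-b : ℂ) * D2 (D2 u) y with hr
  have cr : ContDiff ℝ (⊤ : ℕ∞) r :=
    (((Complex.ofRealCLM.contDiff.comp ck).mul hu).add (contDiff_const.mul hu.D1.D1)).add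
      (contDiff_const.mul hu.D2.D2)
  have pr : MagPeriodic R r :=
    ((pu.ofReal_mul pk).add_const_mul ((pu.D1 hd).D1 hd1) _).add_const_mul
      ((pu.D2 hd).D2 hd2) _
  have hdr := cr.differentiable (by simp)
  have hvar := setIntegral_first_variation_eq_zero hb hu pu cr pr hmin
  have hdiv := DoublyPeriodic.setIntegral_div_eq_zero hR (cr.dot hu.D1) (cr.dot hu.D2)
    (pr.dot (pu.D1 hd)) (pr.dot (pu.D2 hd)) (-R / 2, -R / 2)
  have hsq : ∫ y in Icc ((-R / 2, -R / 2) : ℝ × ℝ) ((-R / 2, -R / 2) + (R, R)),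
      ‖r y‖ ^ 2 = 0 := by
    have hpt : ∀ y, ‖r y‖ ^ 2 = (b * (dot (D1 r y) (D1 u y) + dot (D2 r y) (D2 u y))
        - (1 - ‖u y‖ ^ 2) * dot (r y) (u y))
        - b * (fderiv ℝ (fun y => dot (r y) (D1 u y)) y (1, 0)
          + fderiv ℝ (fun y => dot (r y) (D2 u y)) y (0, 1)) := by
      intro y
      rw [fderiv_dot_D1 hdr hd1, fderiv_dot_D2 hdr hd2, ← dot_self]
      have hre : (r y).re = k y * (u y).re - b * (D1 (D1 u) y).re - b * (D2 (D2 u) y).re := by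
        simp [hr]; ring
      have him : (r y).im = k y * (u y).im - b * (D1 (D1 u) y).im - b * (D2 (D2 u) y).im := by
        simp [hr]; ring
      have : dot (r y) (r y) = k y * dot (r y) (u y) - b * dot (r y) (D1 (D1 u) y)
          - b * dot (r y) (D2 (D2 u) y) := by
        simp only [dot]
        linear_combination (r y).re * hre + (r y).im * him
      rw [this]
      simp only [hk]
      ring
    have cu := hu.continuous
    have c0 := (cr.dot hu).continuous
    have c1 := (cr.D1.dot hu.D1).continuous
    have c2 := (cr.D2.dot hu.D2).continuous
    have c3 := ((cr.dot hu.D1).fderiv_apply_const (1, 0)).continuous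
    have c4 := ((cr.dot hu.D2).fderiv_apply_const (0, 1)).continuous
    simp only [hpt]
    rw [integral_sub (ContinuousOn.integrableOn_Icc (Continuous.continuousOn (by fun_prop)))
      (ContinuousOn.integrableOn_Icc (Continuous.continuousOn (by fun_prop))),
      integral_const_mul, hvar, hdiv]
    simp
  have hz := pr.norm_sq.eq_zero_of_setIntegral_eq_zero hR (cr.norm_sq ℝ).continuous
    (fun _ => by positivity) _ hsq x
  have hz' : r x = 0 := by simpa using hz
  simp only [hr, hk] at hz'
  push_cast at hz'
  linear_combination hz'

lemma fderiv_fderiv_nonpos_of_forall_le {h : ℝ × ℝ → ℝ} (hh : ContDiff ℝ (⊤ : ℕ∞) h)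
    {x : ℝ × ℝ} (hx : ∀ y, h y ≤ h x) (e : ℝ × ℝ) :
    fderiv ℝ (fun y => fderiv ℝ h y e) x e ≤ 0 := by
  have key : ∀ {k : ℝ × ℝ → ℝ}, ContDiff ℝ (⊤ : ℕ∞) k →
      deriv (fun t : ℝ => k (x + t • e)) = fun t => fderiv ℝ k (x + t • e) e := by
    intro k hk
    ext t
    have hl : HasDerivAt (fun t : ℝ => x + t • e) e t := by
      simpa using ((hasDerivAt_id t).smul_const e).const_add x
    exact ((hk.differentiable (by simp) _).hasFDerivAt.comp_hasDerivAt t hl).deriv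
  have h2 : deriv (deriv (fun t : ℝ => h (x + t • e))) 0
      = fderiv ℝ (fun y => fderiv ℝ h y e) x e := by
    rw [key hh, key (hh.fderiv_apply_const e)]
    simp
  rw [← h2]
  by_contra! hpos
  have hc : Continuous (fun t : ℝ => h (x + t • e)) :=
    hh.continuous.comp (by fun_prop)
  have hmax : IsLocalMax (fun t : ℝ => h (x + t • e)) 0 :=
    Filter.Eventually.of_forall fun t => by simpa using hx (x + t • e)
  have hmin := isLocalMin_of_deriv_deriv_pos hpos hmax.deriv_eq_zero hc.continuousAt
  have heq : (fun t : ℝ => h (x + t • e)) =ᶠ[nhds 0] fun _ => h (x + (0 : ℝ) • e) := by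
    filter_upwards [hmin, hmax] with t h1 h2 using le_antisymm h2 h1
  rw [heq.deriv.deriv_eq] at hpos
  simp at hpos

lemma fderiv_norm_sq_D1 {f : ℝ × ℝ → ℂ} (hf : Differentiable ℝ f) (x : ℝ × ℝ) :
    fderiv ℝ (fun y => ‖f y‖ ^ 2) x (1, 0) = 2 * dot (f x) (D1 f x) := by
  simp only [← dot_self]
  rw [fderiv_dot_D1 hf hf, dot_comm]
  ring

lemma fderiv_norm_sq_D2 {f : ℝ × ℝ → ℂ} (hf : Differentiable ℝ f) (x : ℝ × ℝ) :
    fderiv ℝ (fun y => ‖f y‖ ^ 2) x (0, 1) = 2 * dot (f x) (D2 f x) := by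
  simp only [← dot_self]
  rw [fderiv_dot_D2 hf hf, dot_comm]
  ring

lemma fderiv_fderiv_norm_sq_D1 {f : ℝ × ℝ → ℂ} (hf : ContDiff ℝ (⊤ : ℕ∞) f) (x : ℝ × ℝ) :
    fderiv ℝ (fun y => fderiv ℝ (fun z => ‖f z‖ ^ 2) y (1, 0)) x (1, 0)
      = 2 * (‖D1 f x‖ ^ 2 + dot (f x) (D1 (D1 f) x)) := by
  have hd := hf.differentiable (by simp)
  have hd1 := hf.D1.differentiable (by simp)
  simp only [fderiv_norm_sq_D1 hd]
  rw [fderiv_const_mul ((hf.dot hf.D1).differentiable (by simp) x)]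
  simp [fderiv_dot_D1 hd hd1, dot_self]

lemma fderiv_fderiv_norm_sq_D2 {f : ℝ × ℝ → ℂ} (hf : ContDiff ℝ (⊤ : ℕ∞) f) (x : ℝ × ℝ) :
    fderiv ℝ (fun y => fderiv ℝ (fun z => ‖f z‖ ^ 2) y (0, 1)) x (0, 1)
      = 2 * (‖D2 f x‖ ^ 2 + dot (f x) (D2 (D2 f) x)) := by
  have hd := hf.differentiable (by simp)
  have hd1 := hf.D2.differentiable (by simp)
  simp only [fderiv_norm_sq_D2 hd]
  rw [fderiv_const_mul ((hf.dot hf.D2).differentiable (by simp) x)]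
  simp [fderiv_dot_D2 hd hd1, dot_self]

lemma fderiv_fderiv_add_add_const_mul {p q r : ℝ × ℝ → ℝ} (hp : ContDiff ℝ (⊤ : ℕ∞) p)
    (hq : ContDiff ℝ (⊤ : ℕ∞) q) (hr : ContDiff ℝ (⊤ : ℕ∞) r) (c : ℝ) (x e : ℝ × ℝ) :
    fderiv ℝ (fun y => fderiv ℝ (fun z => p z + q z + c * r z) y e) x e
      = fderiv ℝ (fun y => fderiv ℝ p y e) x e + fderiv ℝ (fun y => fderiv ℝ q y e) x e
        + c * fderiv ℝ (fun y => fderiv ℝ r y e) x e := by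
  have key : ∀ {p q r : ℝ × ℝ → ℝ}, ContDiff ℝ (⊤ : ℕ∞) p → ContDiff ℝ (⊤ : ℕ∞) q →
      ContDiff ℝ (⊤ : ℕ∞) r → ∀ y, fderiv ℝ (fun z => p z + q z + c * r z) y e
        = fderiv ℝ p y e + fderiv ℝ q y e + c * fderiv ℝ r y e := by
    intro p q r hp hq hr y
    have dp := hp.differentiable (by simp) y
    have dq := hq.differentiable (by simp) y
    have dr := hr.differentiable (by simp) y
    rw [fderiv_fun_add (dp.fun_add dq) (dr.const_mul c), fderiv_fun_add dp dq,
      fderiv_const_mul dr]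
    simp
  simp only [key hp hq hr]
  exact key (hp.fderiv_apply_const e) (hq.fderiv_apply_const e) (hr.fderiv_apply_const e) x

/-- Second-order condition at a maximum, in terms of magnetic derivatives. -/
lemma magnetic_laplacian_at_max {f g h : ℝ × ℝ → ℂ} (hf : ContDiff ℝ (⊤ : ℕ∞) f)
    (hg : ContDiff ℝ (⊤ : ℕ∞) g) (hh : ContDiff ℝ (⊤ : ℕ∞) h) (c : ℝ) {x : ℝ × ℝ}
    (hx : ∀ y, ‖f y‖ ^ 2 + ‖g y‖ ^ 2 + c * ‖h y‖ ^ 2 ≤ ‖f x‖ ^ 2 + ‖g x‖ ^ 2 + c * ‖h x‖ ^ 2) :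
    (‖D1 f x‖ ^ 2 + ‖D2 f x‖ ^ 2 + dot (f x) (D1 (D1 f) x + D2 (D2 f) x))
      + (‖D1 g x‖ ^ 2 + ‖D2 g x‖ ^ 2 + dot (g x) (D1 (D1 g) x + D2 (D2 g) x))
      + c * (‖D1 h x‖ ^ 2 + ‖D2 h x‖ ^ 2 + dot (h x) (D1 (D1 h) x + D2 (D2 h) x)) ≤ 0 := by
  have sm : ContDiff ℝ (⊤ : ℕ∞) (fun y => ‖f y‖ ^ 2 + ‖g y‖ ^ 2 + c * ‖h y‖ ^ 2) :=
    ((hf.norm_sq ℝ).add (hg.norm_sq ℝ)).add (contDiff_const.mul (hh.norm_sq ℝ))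
  have h1 := fderiv_fderiv_nonpos_of_forall_le sm hx (1, 0)
  have h2 := fderiv_fderiv_nonpos_of_forall_le sm hx (0, 1)
  rw [fderiv_fderiv_add_add_const_mul (hf.norm_sq ℝ) (hg.norm_sq ℝ) (hh.norm_sq ℝ)] at h1 h2
  rw [fderiv_fderiv_norm_sq_D1 hf, fderiv_fderiv_norm_sq_D1 hg, fderiv_fderiv_norm_sq_D1 hh] at h1
  rw [fderiv_fderiv_norm_sq_D2 hf, fderiv_fderiv_norm_sq_D2 hg, fderiv_fderiv_norm_sq_D2 hh] at h2
  have hadd : ∀ z a b : ℂ, dot z (a + b) = dot z a + dot z b := fun z a b => by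
    simp only [dot, Complex.add_re, Complex.add_im]; ring
  simp only [hadd]
  linarith

lemma dot_ofReal_mul_self (k : ℝ) (z : ℂ) : dot z (k * z) = k * ‖z‖ ^ 2 := by
  simp only [← dot_self, dot]
  simp
  ring

/-- The Ginzburg–Landau equation `(∇ - iA₀)² u = -lam (1 - |u|²) u`. -/
def IsGLSolution (lam : ℝ) (u : ℝ × ℝ → ℂ) : Prop :=
  ∀ x, D1 (D1 u) x + D2 (D2 u) x = ((-(lam * (1 - ‖u x‖ ^ 2)) : ℝ) : ℂ) * u x

namespace IsGLSolution

variable {lam R : ℝ} {u : ℝ × ℝ → ℂ}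

lemma norm_le_one (hE : IsGLSolution lam u) (hl : 0 < lam) (hR : 0 < R)
    (hu : ContDiff ℝ (⊤ : ℕ∞) u) (pu : MagPeriodic R u) (y : ℝ × ℝ) : ‖u y‖ ≤ 1 := by
  obtain ⟨x, hx⟩ := pu.norm_sq.exists_forall_le hR (hu.norm_sq ℝ).continuous
  have h := magnetic_laplacian_at_max (f := u) (g := fun _ => 0) (h := u) hu contDiff_const hu 0
    (x := x) (fun y => by simpa using hx y)
  rw [hE x, dot_ofReal_mul_self] at h
  have z1 : D1 (fun _ => (0 : ℂ)) = fun _ => 0 := by ext y; simp [D1]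
  have z2 : D2 (fun _ => (0 : ℂ)) = fun _ => 0 := by ext y; simp [D2]
  have z3 : dot (0 : ℂ) 0 = 0 := by simp [dot]
  simp only [z1, z2, add_zero, z3, norm_zero] at h
  have h' : -(lam * (1 - ‖u x‖ ^ 2)) * ‖u x‖ ^ 2 ≤ 0 := by
    nlinarith [sq_nonneg ‖D1 u x‖, sq_nonneg ‖D2 u x‖]
  have h1 : ‖u x‖ ^ 2 ≤ 1 := by
    by_contra! hc
    have : 0 < lam * (‖u x‖ ^ 2 - 1) * ‖u x‖ ^ 2 :=
      mul_pos (mul_pos hl (by linarith)) (by linarith)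
    linarith
  have h2 := (hx y).trans h1
  exact (sq_le_one_iff₀ (norm_nonneg _)).mp h2

lemma D_D1 (hu : ContDiff ℝ (⊤ : ℕ∞) u) (x : ℝ × ℝ) :
    D1 (D1 (D1 u)) x + D2 (D2 (D1 u)) x
      = D1 (fun y => D1 (D1 u) y + D2 (D2 u) y) x + 2 * Complex.I * D2 u x := by
  have h1 : D2 (D1 u) = fun y => D1 (D2 u) y + Complex.I * u y := by
    ext y; rw [D1_D2_eq hu]; ring
  have h2 : (fun y => D1 (D1 u) y + D2 (D2 u) y) = fun y => D1 (D1 u) y + 1 * D2 (D2 u) y := by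
    simp
  rw [h1, h2, D2_add_const_mul (hu.D2.D1.differentiable (by simp)) (hu.differentiable (by simp)),
    D1_add_const_mul (hu.D1.D1.differentiable (by simp)) (hu.D2.D2.differentiable (by simp)),
    D1_D2_eq hu.D2]
  ring

lemma D_D2 (hu : ContDiff ℝ (⊤ : ℕ∞) u) (x : ℝ × ℝ) :
    D1 (D1 (D2 u)) x + D2 (D2 (D2 u)) x
      = D2 (fun y => D1 (D1 u) y + D2 (D2 u) y) x - 2 * Complex.I * D1 u x := by
  have h1 : D1 (D2 u) = fun y => D2 (D1 u) y + (-Complex.I) * u y := by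
    ext y; rw [D1_D2_eq hu]; ring
  have h2 : (fun y => D1 (D1 u) y + D2 (D2 u) y) = fun y => D1 (D1 u) y + 1 * D2 (D2 u) y := by
    simp
  rw [h1, h2, D1_add_const_mul (hu.D1.D2.differentiable (by simp)) (hu.differentiable (by simp)),
    D2_add_const_mul (hu.D1.D1.differentiable (by simp)) (hu.D2.D2.differentiable (by simp)),
    D1_D2_eq hu.D1]
  ring

/-- Bernstein-type gradient bound. -/
lemma gradient_le (hE : IsGLSolution lam u) (hl : 0 < lam) (hl2 : lam ≤ 2) (hR : 0 < R)
    (hu : ContDiff ℝ (⊤ : ℕ∞) u) (pu : MagPeriodic R u) {m : ℝ} (hm : ∀ y, ‖u y‖ ^ 2 ≤ m)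
    (y : ℝ × ℝ) : ‖D1 u y‖ ^ 2 + ‖D2 u y‖ ^ 2 ≤ 15 * m := by
  have hd := hu.differentiable (by simp)
  have per : DoublyPeriodic R
      (fun y => ‖D1 u y‖ ^ 2 + ‖D2 u y‖ ^ 2 + (lam + 3) * ‖u y‖ ^ 2) := fun z => by
    have h1 := (pu.D1 hd).norm_sq z
    have h2 := (pu.D2 hd).norm_sq z
    have h3 := pu.norm_sq z
    simp only [h1.1, h1.2, h2.1, h2.2, h3.1, h3.2, and_self]
  have cont : Continuous
      (fun y => ‖D1 u y‖ ^ 2 + ‖D2 u y‖ ^ 2 + (lam + 3) * ‖u y‖ ^ 2) := by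
    have h0 := hu.continuous
    have h1 := hu.D1.continuous
    have h2 := hu.D2.continuous
    fun_prop
  obtain ⟨x, hx⟩ := per.exists_forall_le hR cont
  have h := magnetic_laplacian_at_max hu.D1 hu.D2 hu (lam + 3) hx
  have hk : ContDiff ℝ (⊤ : ℕ∞) (fun x => -(lam * (1 - ‖u x‖ ^ 2))) :=
    (contDiff_const.mul (contDiff_const.sub (hu.norm_sq ℝ))).neg
  have hk' : ∀ e, fderiv ℝ (fun x => -(lam * (1 - ‖u x‖ ^ 2))) x e
      = lam * fderiv ℝ (fun x => ‖u x‖ ^ 2) x e := by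
    intro e
    have h0 : (fun x => -(lam * (1 - ‖u x‖ ^ 2))) = fun x => lam * ‖u x‖ ^ 2 - lam := by
      ext; ring
    rw [h0, fderiv_sub_const, fderiv_const_mul ((hu.norm_sq ℝ).differentiable (by simp) x)]
    simp
  rw [D_D1 hu, D_D2 hu] at h
  have hfun : (fun y => D1 (D1 u) y + D2 (D2 u) y)
      = fun y => ((-(lam * (1 - ‖u y‖ ^ 2)) : ℝ) : ℂ) * u y := funext hE
  rw [hE x, hfun, D1_ofReal_mul (hk.differentiable (by simp)) hd,
    D2_ofReal_mul (hk.differentiable (by simp)) hd, hk', hk', fderiv_norm_sq_D1 hd,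
    fderiv_norm_sq_D2 hd, dot_ofReal_mul_self] at h
  have e1 : dot (D1 u x) (((-(lam * (1 - ‖u x‖ ^ 2)) : ℝ) : ℂ) * D1 u x
      + ((lam * (2 * dot (u x) (D1 u x)) : ℝ) : ℂ) * u x + 2 * Complex.I * D2 u x)
      = -(lam * (1 - ‖u x‖ ^ 2)) * ‖D1 u x‖ ^ 2 + 2 * lam * dot (u x) (D1 u x) ^ 2
        + 2 * dot (D1 u x) (Complex.I * D2 u x) := by
    rw [← dot_self (D1 u x)]
    generalize ‖u x‖ ^ 2 = a
    simp only [dot, Complex.add_re, Complex.add_im, Complex.mul_re, Complex.mul_im,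
      Complex.ofReal_re, Complex.ofReal_im, Complex.I_re, Complex.I_im, Complex.re_ofNat,
      Complex.im_ofNat]
    ring
  have e2 : dot (D2 u x) (((-(lam * (1 - ‖u x‖ ^ 2)) : ℝ) : ℂ) * D2 u x
      + ((lam * (2 * dot (u x) (D2 u x)) : ℝ) : ℂ) * u x - 2 * Complex.I * D1 u x)
      = -(lam * (1 - ‖u x‖ ^ 2)) * ‖D2 u x‖ ^ 2 + 2 * lam * dot (u x) (D2 u x) ^ 2
        + 2 * dot (D1 u x) (Complex.I * D2 u x) := by
    rw [← dot_self (D2 u x)]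
    generalize ‖u x‖ ^ 2 = a
    simp only [dot, Complex.add_re, Complex.add_im, Complex.mul_re, Complex.mul_im,
      Complex.ofReal_re, Complex.ofReal_im, Complex.I_re, Complex.I_im, Complex.re_ofNat,
      Complex.im_ofNat, Complex.sub_re, Complex.sub_im]
    ring
  rw [e1, e2] at h
  have e3 : -(‖D1 u x‖ ^ 2 + ‖D2 u x‖ ^ 2) ≤ 2 * dot (D1 u x) (Complex.I * D2 u x) := by
    have h1 := abs_dot_le (D1 u x) (Complex.I * D2 u x)
    rw [norm_mul, Complex.norm_I, one_mul] at h1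
    nlinarith [neg_abs_le (dot (D1 u x) (Complex.I * D2 u x)),
      sq_nonneg (‖D1 u x‖ - ‖D2 u x‖)]
  have p1 : 0 ≤ lam * dot (u x) (D1 u x) ^ 2 := by positivity
  have p2 : 0 ≤ lam * dot (u x) (D2 u x) ^ 2 := by positivity
  have p3 : 0 ≤ lam * ‖u x‖ ^ 2 * ‖D1 u x‖ ^ 2 := by positivity
  have p4 : 0 ≤ lam * ‖u x‖ ^ 2 * ‖D2 u x‖ ^ 2 := by positivity
  have p5 : 0 ≤ (lam + 3) * lam * ‖u x‖ ^ 2 * ‖u x‖ ^ 2 := by positivity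
  have hb : ‖D1 u x‖ ^ 2 + ‖D2 u x‖ ^ 2 ≤ (lam + 3) * lam * ‖u x‖ ^ 2 := by
    nlinarith [sq_nonneg ‖D1 (D1 u) x‖, sq_nonneg ‖D2 (D1 u) x‖, sq_nonneg ‖D1 (D2 u) x‖,
      sq_nonneg ‖D2 (D2 u) x‖]
  have hxy := hx y
  have hmx := hm x
  have q1 : 0 ≤ (lam + 3) * ‖u y‖ ^ 2 := by positivity
  have hm0 : 0 ≤ m := (sq_nonneg _).trans hmx
  have q2 : (lam + 3) * (lam + 1) * ‖u x‖ ^ 2 ≤ 15 * m := by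
    apply mul_le_mul _ hmx (by positivity) (by norm_num)
    nlinarith
  nlinarith

end IsGLSolution

/-- Positive smooth periodic weights whose logarithmic derivatives are bounded by `δ`. -/
structure IsSlowWeight (R δ : ℝ) (w : ℝ × ℝ → ℝ) : Prop where
  contDiff : ContDiff ℝ (⊤ : ℕ∞) w
  periodic : DoublyPeriodic R w
  pos : ∀ x, 0 < w x
  abs_fderiv_fst_le : ∀ x, |fderiv ℝ w x (1, 0)| ≤ δ * w x
  abs_fderiv_snd_le : ∀ x, |fderiv ℝ w x (0, 1)| ≤ δ * w x

lemma isSlowWeight_one (R : ℝ) : IsSlowWeight R 0 (fun _ => 1) where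
  contDiff := contDiff_const
  periodic := fun _ => ⟨rfl, rfl⟩
  pos := fun _ => one_pos
  abs_fderiv_fst_le := fun x => by simp
  abs_fderiv_snd_le := fun x => by simp

lemma IsSlowWeight.setIntegral_nonpos {R δ : ℝ} {w F G p : ℝ × ℝ → ℝ}
    (hw : IsSlowWeight R δ w) (hR : 0 < R)
    (hF : ContDiff ℝ (⊤ : ℕ∞) F) (hG : ContDiff ℝ (⊤ : ℕ∞) G)
    (pF : DoublyPeriodic R F) (pG : DoublyPeriodic R G) (hp : Continuous p)
    (h : ∀ x, p x ≤ w x * (fderiv ℝ F x (1, 0) + fderiv ℝ G x (0, 1))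
      - δ * w x * (|F x| + |G x|)) (q : ℝ × ℝ) :
    ∫ x in Icc q (q + (R, R)), p x ≤ 0 := by
  rw [← DoublyPeriodic.setIntegral_mul_div hR hw.contDiff hF hG hw.periodic pF pG q]
  have c0 := hw.contDiff.continuous
  have c1 := (hw.contDiff.fderiv_apply_const (1, 0)).continuous
  have c2 := (hw.contDiff.fderiv_apply_const (0, 1)).continuous
  have c3 := (hF.fderiv_apply_const (1, 0)).continuous
  have c4 := (hG.fderiv_apply_const (0, 1)).continuous
  have c5 := hF.continuous
  have c6 := hG.continuous
  refine integral_mono hp.continuousOn.integrableOn_Icc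
    (Continuous.integrableOn_Icc (by fun_prop)) fun x => (h x).trans ?_
  have b1 : |fderiv ℝ w x (1, 0) * F x| ≤ δ * w x * |F x| := by
    rw [abs_mul]
    exact mul_le_mul_of_nonneg_right (hw.abs_fderiv_fst_le x) (abs_nonneg _)
  have b2 : |fderiv ℝ w x (0, 1) * G x| ≤ δ * w x * |G x| := by
    rw [abs_mul]
    exact mul_le_mul_of_nonneg_right (hw.abs_fderiv_snd_le x) (abs_nonneg _)
  have b3 := neg_abs_le (fderiv ℝ w x (1, 0) * F x)
  have b4 := neg_abs_le (fderiv ℝ w x (0, 1) * G x)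
  linarith

/-- The annihilation operator `D₁ + iD₂`, whose kernel is the lowest Landau band. -/
noncomputable def annih (u : ℝ × ℝ → ℂ) (x : ℝ × ℝ) : ℂ := D1 u x + Complex.I * D2 u x

/-- The operator `D₁ - iD₂`, minus the formal adjoint of `annih`. -/
noncomputable def creat (u : ℝ × ℝ → ℂ) (x : ℝ × ℝ) : ℂ := D1 u x + (-Complex.I) * D2 u x

lemma ContDiff.annih {u : ℝ × ℝ → ℂ} (hu : ContDiff ℝ (⊤ : ℕ∞) u) :
    ContDiff ℝ (⊤ : ℕ∞) (annih u) :=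
  hu.D1.add (contDiff_const.mul hu.D2)

lemma ContDiff.creat {u : ℝ × ℝ → ℂ} (hu : ContDiff ℝ (⊤ : ℕ∞) u) :
    ContDiff ℝ (⊤ : ℕ∞) (creat u) :=
  hu.D1.add (contDiff_const.mul hu.D2)

lemma MagPeriodic.annih {R : ℝ} {u : ℝ × ℝ → ℂ} (hd : Differentiable ℝ u)
    (pu : MagPeriodic R u) : MagPeriodic R (annih u) :=
  (pu.D1 hd).add_const_mul (pu.D2 hd) _

lemma D2_const_mul {f : ℝ × ℝ → ℂ} (hf : Differentiable ℝ f) (c : ℂ) (x : ℝ × ℝ) :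
    D2 (fun y => c * f y) x = c * D2 f x := by
  simp only [D2]
  rw [fderiv_const_mul (hf x)]
  simp
  ring

lemma creat_annih {u : ℝ × ℝ → ℂ} (hu : ContDiff ℝ (⊤ : ℕ∞) u) (x : ℝ × ℝ) :
    creat (annih u) x = D1 (D1 u) x + D2 (D2 u) x + u x := by
  have d1 := hu.D1.differentiable (by simp)
  have d2 := hu.D2.differentiable (by simp)
  have h : annih u = fun y => D1 u y + Complex.I * D2 u y := rfl
  rw [creat, h, D1_add_const_mul d1 d2, D2_add_const_mul d1 d2, D1_D2_eq hu]
  linear_combination (-u x - D2 (D2 u) x) * Complex.I_sq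

/-- Weighted lower bound for `(D₁ - iD₂)f`, from the commutation relation. -/
lemma setIntegral_creat {R δ : ℝ} {w : ℝ × ℝ → ℝ} (hw : IsSlowWeight R δ w) (hδ : 0 ≤ δ)
    (hδ1 : δ ≤ 1) (hR : 0 < R) {f : ℝ × ℝ → ℂ} (hf : ContDiff ℝ (⊤ : ℕ∞) f)
    (pf : MagPeriodic R f) (q : ℝ × ℝ) :
    ∫ x in Icc q (q + (R, R)), w x * ((1 - δ) * ‖f x‖ ^ 2 - ‖creat f x‖ ^ 2) ≤ 0 := by
  have hd := hf.differentiable (by simp)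
  have hd1 := hf.D1.differentiable (by simp)
  have hd2 := hf.D2.differentiable (by simp)
  have hI : ∀ c : ℂ, ContDiff ℝ (⊤ : ℕ∞) (fun y => c * f y) := fun c => contDiff_const.mul hf
  have cw := hw.contDiff.continuous
  have cf := hf.continuous
  have cc := hf.creat.continuous
  have hD1I : ∀ c x, D1 (fun y => c * f y) x = c * D1 f x := fun c x => by
    simp only [D1]
    rw [fderiv_const_mul (hd x)]
    simp
    ring
  refine hw.setIntegral_nonpos hR ((hI (-Complex.I)).dot hf.D2) ((hI Complex.I).dot hf.D1)
    ((pf.const_mul _).dot (pf.D2 hd)) ((pf.const_mul _).dot (pf.D1 hd)) (by fun_prop)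
    (fun x => ?_) q
  rw [fderiv_dot_D1 ((hI _).differentiable (by simp)) hd2,
    fderiv_dot_D2 ((hI _).differentiable (by simp)) hd1, hD1I, D2_const_mul hd, D1_D2_eq hf]
  have id : ‖f x‖ ^ 2 - ‖creat f x‖ ^ 2 = -(‖D1 f x‖ ^ 2 + ‖D2 f x‖ ^ 2)
      + (dot (-Complex.I * D1 f x) (D2 f x)
        + dot (-Complex.I * f x) (D2 (D1 f) x - Complex.I * f x)
        + (dot (Complex.I * D2 f x) (D1 f x) + dot (Complex.I * f x) (D2 (D1 f) x))) := by
    simp only [← dot_self, creat, dot]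
    simp
    ring
  have b1 := abs_dot_le (-Complex.I * f x) (D2 f x)
  have b2 := abs_dot_le (Complex.I * f x) (D1 f x)
  simp only [norm_mul, norm_neg, Complex.norm_I, one_mul] at b1 b2
  have b3 : |dot (-Complex.I * f x) (D2 f x)| + |dot (Complex.I * f x) (D1 f x)|
      ≤ ‖f x‖ ^ 2 + (‖D1 f x‖ ^ 2 + ‖D2 f x‖ ^ 2) := by
    nlinarith [sq_nonneg (‖f x‖ - ‖D2 f x‖), sq_nonneg (‖f x‖ - ‖D1 f x‖),
      sq_nonneg ‖D1 f x‖, sq_nonneg ‖D2 f x‖]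
  have b4 := mul_le_mul_of_nonneg_left b3 (mul_nonneg hδ (hw.pos x).le)
  have b5 : 0 ≤ (1 - δ) * w x * (‖D1 f x‖ ^ 2 + ‖D2 f x‖ ^ 2) :=
    mul_nonneg (mul_nonneg (by linarith) (hw.pos x).le) (by positivity)
  have id' := congrArg (fun t => w x * t) id
  linarith

namespace IsGLSolution

variable {lam R : ℝ} {u : ℝ × ℝ → ℂ}

lemma creat_annih_eq (hE : IsGLSolution lam u) (hu : ContDiff ℝ (⊤ : ℕ∞) u) (x : ℝ × ℝ) :
    creat (annih u) x = ((1 - lam + lam * ‖u x‖ ^ 2 : ℝ) : ℂ) * u x := by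
  rw [creat_annih hu, hE x]
  push_cast
  ring

/-- Weighted energy identity, with the terms involving derivatives of the weight estimated. -/
lemma setIntegral_energy (hE : IsGLSolution lam u) {δ : ℝ} {w : ℝ × ℝ → ℝ}
    (hw : IsSlowWeight R δ w) (hδ : 0 ≤ δ) (hR : 0 < R)
    (hu : ContDiff ℝ (⊤ : ℕ∞) u) (pu : MagPeriodic R u) {τ : ℝ} (hτ : 0 < τ) (q : ℝ × ℝ) :
    ∫ x in Icc q (q + (R, R)), w x * (lam * ‖u x‖ ^ 4 + ‖annih u x‖ ^ 2
      - (lam - 1) * ‖u x‖ ^ 2 - δ * (τ * ‖u x‖ ^ 2 + ‖annih u x‖ ^ 2 / τ)) ≤ 0 := by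
  have hd := hu.differentiable (by simp)
  have ha := hu.annih
  have hda := ha.differentiable (by simp)
  have pa := pu.annih hd
  have hI : ContDiff ℝ (⊤ : ℕ∞) (fun y => (-Complex.I) * annih u y) := contDiff_const.mul ha
  have cw := hw.contDiff.continuous
  have cu := hu.continuous
  have ca := ha.continuous
  refine hw.setIntegral_nonpos hR (hu.dot ha) (hu.dot hI)
    (pu.dot pa) (pu.dot (pa.const_mul _)) (by fun_prop) (fun x => ?_) q
  rw [fderiv_dot_D1 hd hda, fderiv_dot_D2 hd (hI.differentiable (by simp)), D2_const_mul hda]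
  have id : lam * ‖u x‖ ^ 4 + ‖annih u x‖ ^ 2 - (lam - 1) * ‖u x‖ ^ 2
      = dot (D1 u x) (annih u x) + dot (u x) (D1 (annih u) x)
        + (dot (D2 u x) (-Complex.I * annih u x) + dot (u x) (-Complex.I * D2 (annih u) x)) := by
    have h1 : dot (u x) (creat (annih u) x) = (1 - lam + lam * ‖u x‖ ^ 2) * ‖u x‖ ^ 2 := by
      rw [hE.creat_annih_eq hu, dot_ofReal_mul_self]
    have h2 : dot (u x) (creat (annih u) x)
        = dot (u x) (D1 (annih u) x) + dot (u x) (-Complex.I * D2 (annih u) x) := by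
      simp only [creat, dot, Complex.add_re, Complex.add_im]; ring
    have h3 : ‖annih u x‖ ^ 2
        = dot (D1 u x) (annih u x) + dot (D2 u x) (-Complex.I * annih u x) := by
      rw [← dot_self]
      simp only [dot, annih]
      simp
      ring
    linear_combination h2 - h1 + h3
  have b1 := abs_dot_le (u x) (annih u x)
  have b2 := abs_dot_le (u x) (-Complex.I * annih u x)
  simp only [norm_mul, norm_neg, Complex.norm_I, one_mul] at b2
  have b3 : 2 * (‖u x‖ * ‖annih u x‖) ≤ τ * ‖u x‖ ^ 2 + ‖annih u x‖ ^ 2 / τ := by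
    have h1 : ‖annih u x‖ = τ * (‖annih u x‖ / τ) := by field_simp
    have h2 : ‖annih u x‖ ^ 2 / τ = τ * (‖annih u x‖ / τ) ^ 2 := by field_simp
    rw [h2]
    nth_rewrite 1 [h1]
    nlinarith [mul_nonneg hτ.le (sq_nonneg (‖u x‖ - ‖annih u x‖ / τ))]
  have b4 := mul_le_mul_of_nonneg_left ((add_le_add b1 b2).trans ((two_mul _).ge.trans b3))
    (mul_nonneg hδ (hw.pos x).le)
  have id' := congrArg (fun t => w x * t) id
  linarith

/-- At or above the critical field `b = 1` the only solution is trivial. -/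
lemma eq_zero_of_le_one (hE : IsGLSolution lam u) (hl : 0 < lam) (hl1 : lam ≤ 1) (hR : 0 < R)
    (hu : ContDiff ℝ (⊤ : ℕ∞) u) (pu : MagPeriodic R u) (x : ℝ × ℝ) : u x = 0 := by
  have h := hE.setIntegral_energy (isSlowWeight_one R) le_rfl hR hu pu one_pos 0
  have cu := hu.continuous
  have ca := hu.annih.continuous
  have h4 : ∫ x in Icc (0 : ℝ × ℝ) (0 + (R, R)), lam * (‖u x‖ ^ 2 * ‖u x‖ ^ 2) = 0 := by
    refine le_antisymm (le_trans (integral_mono (Continuous.integrableOn_Icc (by fun_prop))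
      (Continuous.integrableOn_Icc (by fun_prop)) fun x => ?_) h)
      (integral_nonneg fun x => by positivity)
    have : 0 ≤ (1 - lam) * ‖u x‖ ^ 2 := mul_nonneg (by linarith) (by positivity)
    nlinarith [sq_nonneg ‖annih u x‖]
  rw [integral_const_mul, mul_eq_zero, or_iff_right hl.ne'] at h4
  have := (pu.norm_sq.mul pu.norm_sq).eq_zero_of_setIntegral_eq_zero hR (by fun_prop)
    (fun x => by positivity) 0 h4 x
  simpa using this

end IsGLSolution

lemma exists_slow_weight_one_dim {R δ : ℝ} (hR : 0 < R) (hδ : 0 < δ) (c : ℝ) :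
    ∃ k : ℝ → ℝ, ContDiff ℝ (⊤ : ℕ∞) k ∧ Function.Periodic k R ∧ (∀ t, 0 < k t) ∧
      (∀ t, |deriv k t| ≤ δ * k t) ∧ (∀ t, (1 + δ ^ 2 * (t - c) ^ 2)⁻¹ ≤ k t) ∧
      (∀ t, |t - c| ≤ R / 2 → k t ≤ (1 + (2 * δ / Real.pi * (t - c)) ^ 2)⁻¹) := by
  have hpi := Real.pi_pos
  set s : ℝ → ℝ := fun t => δ * R / Real.pi * Real.sin (Real.pi / R * (t - c)) with hs
  have cs : ContDiff ℝ (⊤ : ℕ∞) s := by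
    simp only [hs]
    fun_prop
  have hpos : ∀ t, 0 < 1 + s t ^ 2 := fun t => by positivity
  have hder : ∀ t, HasDerivAt s (δ * Real.cos (Real.pi / R * (t - c))) t := by
    intro t
    have h1 := ((((hasDerivAt_id t).sub_const c).const_mul (Real.pi / R)).sin).const_mul
      (δ * R / Real.pi)
    refine h1.congr_deriv ?_
    simp only [id]
    field_simp
  refine ⟨fun t => (1 + s t ^ 2)⁻¹, (contDiff_const.add (cs.pow 2)).inv fun t => (hpos t).ne',
    ?_, fun t => inv_pos.mpr (hpos t), ?_, ?_, ?_⟩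
  · intro t
    have : s (t + R) = - s t := by
      simp only [hs]
      rw [show Real.pi / R * (t + R - c) = Real.pi / R * (t - c) + Real.pi by field_simp; ring,
        Real.sin_add_pi]
      ring
    simp only [this, neg_sq]
  · intro t
    have h1 := ((((hder t).fun_pow 2).const_add 1).fun_inv (hpos t).ne').deriv
    rw [h1, abs_div, abs_neg, abs_of_pos (pow_pos (hpos t) 2), div_le_iff₀ (pow_pos (hpos t) 2)]
    have h2 : δ * (1 + s t ^ 2)⁻¹ * (1 + s t ^ 2) ^ 2 = δ * (1 + s t ^ 2) := by
      have := (hpos t).ne'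
      field_simp
    rw [h2]
    have h3 : |Real.cos (Real.pi / R * (t - c))| ≤ 1 := Real.abs_cos_le_one _
    have h4 : 2 * |s t| ≤ 1 + s t ^ 2 := by
      nlinarith [sq_nonneg (|s t| - 1), sq_abs (s t)]
    simp only [Nat.cast_ofNat, Nat.add_one_sub_one, pow_one, abs_mul, abs_two, abs_of_pos hδ]
    calc 2 * |s t| * (δ * |Real.cos (Real.pi / R * (t - c))|)
        ≤ 2 * |s t| * (δ * 1) := by gcongr
      _ ≤ δ * (1 + s t ^ 2) := by nlinarith
  · intro t
    apply inv_anti₀ (hpos t)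
    have h1 : |s t| ≤ |δ * (t - c)| := by
      simp only [hs, abs_mul]
      rw [abs_of_pos (by positivity : 0 < δ * R / Real.pi)]
      calc δ * R / Real.pi * |Real.sin (Real.pi / R * (t - c))|
          ≤ δ * R / Real.pi * |Real.pi / R * (t - c)| := by
            exact mul_le_mul_of_nonneg_left Real.abs_sin_le_abs (by positivity)
        _ = |δ| * |t - c| := by
            rw [abs_mul, abs_of_pos (by positivity : 0 < Real.pi / R), abs_of_pos hδ]
            field_simp
    have h2 := sq_le_sq.mpr h1
    linarith [mul_pow δ (t - c) 2]
  · intro t ht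
    apply inv_anti₀ (by positivity)
    have h1 : |2 * δ / Real.pi * (t - c)| ≤ |s t| := by
      simp only [hs, abs_mul]
      rw [abs_of_pos (by positivity : 0 < δ * R / Real.pi),
        abs_of_pos (by positivity : 0 < 2 * δ / Real.pi)]
      have h2 : Real.pi / R * |t - c| ≤ Real.pi / 2 := by
        calc Real.pi / R * |t - c| ≤ Real.pi / R * (R / 2) := by gcongr
          _ = Real.pi / 2 := by field_simp
      have h3 := Real.mul_le_sin (by positivity : 0 ≤ Real.pi / R * |t - c|) h2
      have h4 : Real.sin (Real.pi / R * |t - c|) ≤ |Real.sin (Real.pi / R * (t - c))| := by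
        rcases abs_cases (t - c) with ⟨h, -⟩ | ⟨h, -⟩
        · rw [h]; exact le_abs_self _
        · rw [h, mul_neg, Real.sin_neg]; exact neg_le_abs _
      calc 2 * δ / Real.pi * |t - c|
          = δ * R / Real.pi * (2 / Real.pi * (Real.pi / R * |t - c|)) := by field_simp
        _ ≤ _ := by gcongr; exact h3.trans h4
    have h2 := sq_le_sq.mpr h1
    linarith

lemma setIntegral_le_of_le_inv {R δ c : ℝ} (hδ : 0 < δ) {k : ℝ → ℝ} (hk : Continuous k)
    (h : ∀ t, |t - c| ≤ R / 2 → k t ≤ (1 + (2 * δ / Real.pi * (t - c)) ^ 2)⁻¹) :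
    ∫ t in Icc (c - R / 2) (c - R / 2 + R), k t ≤ 5 / δ := by
  have hpi := Real.pi_pos
  have hκ : 2 * δ / Real.pi ≠ 0 := by positivity
  have hint : Integrable (fun t => (1 + (2 * δ / Real.pi * (t - c)) ^ 2)⁻¹) :=
    (integrable_inv_one_add_sq.comp_mul_left' hκ).comp_sub_right c
  calc ∫ t in Icc (c - R / 2) (c - R / 2 + R), k t
      ≤ ∫ t in Icc (c - R / 2) (c - R / 2 + R), (1 + (2 * δ / Real.pi * (t - c)) ^ 2)⁻¹ :=
        setIntegral_mono_on hk.integrableOn_Icc hint.integrableOn measurableSet_Icc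
          fun t ht => h t (abs_le.mpr ⟨by linarith [ht.1], by linarith [ht.2]⟩)
    _ ≤ ∫ t, (1 + (2 * δ / Real.pi * (t - c)) ^ 2)⁻¹ :=
        setIntegral_le_integral hint (ae_of_all _ fun t => by positivity)
    _ = Real.pi ^ 2 / (2 * δ) := by
        rw [integral_sub_right_eq_self (fun t => (1 + (2 * δ / Real.pi * t) ^ 2)⁻¹) c,
          Measure.integral_comp_mul_left (fun t => (1 + t ^ 2)⁻¹), integral_univ_inv_one_add_sq,
          abs_of_pos (by positivity)]
        simp only [smul_eq_mul]
        field_simp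
    _ ≤ 5 / δ := by
        rw [div_le_div_iff₀ (by positivity) hδ]
        have : Real.pi ^ 2 ≤ 10 := by nlinarith [Real.pi_lt_d2]
        nlinarith

lemma exists_slow_weight {R δ : ℝ} (hR : 0 < R) (hδ : 0 < δ) (hδ1 : δ ≤ 1) (c : ℝ × ℝ) :
    ∃ w : ℝ × ℝ → ℝ, IsSlowWeight R δ w ∧
      (∀ x ∈ Icc (c - (1 / 32, 1 / 32)) (c + (1 / 32, 1 / 32)), 1 / 4 ≤ w x) ∧
      ∫ x in Icc (c - (R / 2, R / 2)) (c - (R / 2, R / 2) + (R, R)), w x ≤ 25 / δ ^ 2 := by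
  obtain ⟨k, sk, pk, k0, dk, lk, uk⟩ := exists_slow_weight_one_dim hR hδ c.1
  obtain ⟨l, sl, pl, l0, dl, ll, ul⟩ := exists_slow_weight_one_dim hR hδ c.2
  have hfst : ∀ x : ℝ × ℝ, HasFDerivAt (fun x : ℝ × ℝ => k x.1 * l x.2)
      (k x.1 • (deriv l x.2 • ContinuousLinearMap.snd ℝ ℝ ℝ)
        + l x.2 • (deriv k x.1 • ContinuousLinearMap.fst ℝ ℝ ℝ)) x := fun x =>
    ((sk.differentiable (by simp) x.1).hasDerivAt.comp_hasFDerivAt x hasFDerivAt_fst).mul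
      ((sl.differentiable (by simp) x.2).hasDerivAt.comp_hasFDerivAt x hasFDerivAt_snd)
  have half : ∀ s : ℝ, |s| ≤ 1 / 32 → 1 / 2 ≤ (1 + δ ^ 2 * s ^ 2)⁻¹ := by
    intro s hs
    rw [one_div]
    apply inv_anti₀ (by positivity)
    have h1 : δ ^ 2 ≤ 1 := pow_le_one₀ hδ.le hδ1
    have h2 : s ^ 2 ≤ 1 := by
      rw [← sq_abs]
      exact pow_le_one₀ (abs_nonneg _) (hs.trans (by norm_num))
    have h3 := mul_le_mul h1 h2 (sq_nonneg _) zero_le_one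
    linarith
  refine ⟨fun x => k x.1 * l x.2, ⟨(sk.comp contDiff_fst).mul (sl.comp contDiff_snd),
    fun x => ⟨by simp only [pk x.1], by simp only [pl x.2]⟩, fun x => mul_pos (k0 _) (l0 _),
    fun x => ?_, fun x => ?_⟩, fun x hx => ?_, ?_⟩
  · rw [(hfst x).fderiv]
    simp only [add_apply, smul_apply,
      ContinuousLinearMap.coe_snd', ContinuousLinearMap.coe_fst', smul_eq_mul, mul_zero,
      zero_add, mul_one, abs_mul, abs_of_pos (l0 _)]
    nlinarith [mul_le_mul_of_nonneg_left (dk x.1) (l0 x.2).le]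
  · rw [(hfst x).fderiv]
    simp only [add_apply, smul_apply,
      ContinuousLinearMap.coe_snd', ContinuousLinearMap.coe_fst', smul_eq_mul, mul_zero,
      add_zero, mul_one, abs_mul, abs_of_pos (k0 _)]
    nlinarith [mul_le_mul_of_nonneg_left (dl x.2) (k0 x.1).le]
  · obtain ⟨⟨h1, h2⟩, ⟨h3, h4⟩⟩ := hx
    simp only [Prod.fst_sub, Prod.snd_sub, Prod.fst_add, Prod.snd_add] at h1 h2 h3 h4
    have a1 := (half _ (abs_le.mpr ⟨by linarith, by linarith⟩)).trans (lk x.1)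
    have a2 := (half _ (abs_le.mpr ⟨by linarith, by linarith⟩)).trans (ll x.2)
    have := mul_le_mul a1 a2 (by norm_num) (k0 x.1).le
    norm_num at this ⊢
    exact this
  · have i1 := setIntegral_le_of_le_inv hδ sk.continuous uk
    have i2 := setIntegral_le_of_le_inv hδ sl.continuous ul
    rw [← Icc_prod_Icc, Measure.volume_eq_prod, setIntegral_prod_mul]
    calc _ ≤ 5 / δ * (5 / δ) :=
          mul_le_mul i1 i2 (integral_nonneg fun t => (l0 t).le) (by positivity)
      _ = 25 / δ ^ 2 := by field_simp; norm_num

namespace IsGLSolution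

variable {lam R : ℝ} {u : ℝ × ℝ → ℂ}

lemma half_le_norm_sq (hE : IsGLSolution lam u) (hl : 0 < lam) (hl2 : lam ≤ 2) (hR : 0 < R)
    (hu : ContDiff ℝ (⊤ : ℕ∞) u) (pu : MagPeriodic R u) {m : ℝ} (hm : ∀ y, ‖u y‖ ^ 2 ≤ m)
    {x₀ : ℝ × ℝ} (hx₀ : ‖u x₀‖ ^ 2 = m) {x : ℝ × ℝ}
    (hx : x ∈ Icc (x₀ - (1 / 32, 1 / 32)) (x₀ + (1 / 32, 1 / 32))) :
    m / 2 ≤ ‖u x‖ ^ 2 := by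
  have hd := hu.differentiable (by simp)
  have hm0 : 0 ≤ m := hx₀ ▸ sq_nonneg _
  have hdn : Differentiable ℝ fun y => ‖u y‖ ^ 2 := (hu.norm_sq ℝ).differentiable (by simp)
  have key : ∀ y (d : ℂ), ‖d‖ ^ 2 ≤ 15 * m → |2 * dot (u y) d| ≤ 8 * m := by
    intro y d hdm
    rw [abs_mul, abs_two]
    have h1 := abs_dot_le (u y) d
    have h2 : ‖u y‖ * ‖d‖ ≤ 4 * m :=
      abs_le_of_sq_le_sq' (by nlinarith [mul_le_mul (hm y) hdm (sq_nonneg _) hm0])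
        (by positivity) |>.2
    linarith
  have hbound : ∀ y, ‖fderiv ℝ (fun y => ‖u y‖ ^ 2) y‖ ≤ 16 * m := by
    intro y
    have hg := hE.gradient_le hl hl2 hR hu pu hm y
    have h1 := key y (D1 u y) (by nlinarith [sq_nonneg ‖D2 u y‖])
    have h2 := key y (D2 u y) (by nlinarith [sq_nonneg ‖D1 u y‖])
    rw [← fderiv_norm_sq_D1 hd] at h1
    rw [← fderiv_norm_sq_D2 hd] at h2
    refine ContinuousLinearMap.opNorm_le_bound _ (by positivity) fun v => ?_
    have hv : v = v.1 • ((1, 0) : ℝ × ℝ) + v.2 • ((0, 1) : ℝ × ℝ) := by ext <;> simp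
    have hv1 : |v.1| ≤ ‖v‖ := norm_fst_le v
    have hv2 : |v.2| ≤ ‖v‖ := norm_snd_le v
    rw [hv, map_add, map_smul, map_smul, ← hv]
    refine (norm_add_le _ _).trans ?_
    rw [norm_smul, norm_smul, Real.norm_eq_abs, Real.norm_eq_abs, Real.norm_eq_abs,
      Real.norm_eq_abs]
    have h3 := mul_le_mul hv1 h1 (abs_nonneg _) (norm_nonneg v)
    have h4 := mul_le_mul hv2 h2 (abs_nonneg _) (norm_nonneg v)
    linarith
  have hlip := convex_univ.norm_image_sub_le_of_norm_fderiv_le (𝕜 := ℝ) (x := x₀) (y := x)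
    (fun y _ => hdn y) (fun y _ => hbound y) (mem_univ _) (mem_univ _)
  have hdist : ‖x - x₀‖ ≤ 1 / 32 := by
    obtain ⟨⟨h1, h2⟩, ⟨h3, h4⟩⟩ := hx
    simp only [Prod.fst_sub, Prod.snd_sub, Prod.fst_add, Prod.snd_add] at h1 h2 h3 h4
    refine norm_prod_le_iff.mpr ⟨abs_le.mpr ⟨?_, ?_⟩, abs_le.mpr ⟨?_, ?_⟩⟩ <;>
      simp only [Prod.fst_sub, Prod.snd_sub] <;> linarith
  have h1 := mul_le_mul_of_nonneg_left hdist (by positivity : 0 ≤ 16 * m)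
  have h2 := neg_le_of_abs_le (hlip.trans h1)
  rw [hx₀] at h2
  linarith

lemma sq_le_setIntegral (hE : IsGLSolution lam u) (hl : 0 < lam) (hl2 : lam ≤ 2) (hR : 1 ≤ R)
    (hu : ContDiff ℝ (⊤ : ℕ∞) u) (pu : MagPeriodic R u) {m : ℝ} (hm : ∀ y, ‖u y‖ ^ 2 ≤ m)
    {x₀ : ℝ × ℝ} (hx₀ : ‖u x₀‖ ^ 2 = m) {w : ℝ × ℝ → ℝ} (cw : Continuous w)
    (w0 : ∀ x, 0 ≤ w x)
    (hw : ∀ x ∈ Icc (x₀ - (1 / 32, 1 / 32)) (x₀ + (1 / 32, 1 / 32)), 1 / 4 ≤ w x) :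
    m ^ 2 ≤ 4096 * ∫ x in Icc (x₀ - (R / 2, R / 2)) (x₀ - (R / 2, R / 2) + (R, R)),
      w x * ‖u x‖ ^ 4 := by
  have cu := hu.continuous
  have hm0 : 0 ≤ m := hx₀ ▸ sq_nonneg _
  have hvol : volume.real (Icc (x₀ - (1 / 32, 1 / 32)) (x₀ + (1 / 32, 1 / 32))) = 1 / 256 := by
    rw [← Icc_prod_Icc, Measure.volume_eq_prod, measureReal_prod_prod, Real.volume_real_Icc,
      Real.volume_real_Icc]
    simp only [Prod.fst_sub, Prod.snd_sub, Prod.fst_add, Prod.snd_add]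
    rw [max_eq_left (by linarith), max_eq_left (by linarith)]
    ring
  have hsub : Icc (x₀ - (1 / 32, 1 / 32)) (x₀ + (1 / 32, 1 / 32)) ⊆
      Icc (x₀ - (R / 2, R / 2)) (x₀ - (R / 2, R / 2) + (R, R)) := by
    refine Icc_subset_Icc ⟨?_, ?_⟩ ⟨?_, ?_⟩ <;>
      simp only [Prod.fst_sub, Prod.snd_sub, Prod.fst_add, Prod.snd_add] <;> linarith
  have h1 : ∫ _ in Icc (x₀ - (1 / 32, 1 / 32)) (x₀ + (1 / 32, 1 / 32)), m ^ 2 / 16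
      ≤ ∫ x in Icc (x₀ - (1 / 32, 1 / 32)) (x₀ + (1 / 32, 1 / 32)), w x * ‖u x‖ ^ 4 := by
    refine setIntegral_mono_on (Continuous.integrableOn_Icc (by fun_prop))
      (Continuous.integrableOn_Icc (by fun_prop)) measurableSet_Icc fun x hx => ?_
    have h2 := hE.half_le_norm_sq hl hl2 (by linarith) hu pu hm hx₀ hx
    have h3 : (m / 2) ^ 2 ≤ (‖u x‖ ^ 2) ^ 2 := pow_le_pow_left₀ (by linarith) h2 2
    calc m ^ 2 / 16 = 1 / 4 * (m / 2) ^ 2 := by ring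
      _ ≤ w x * (‖u x‖ ^ 2) ^ 2 := mul_le_mul (hw x hx) h3 (sq_nonneg _) (w0 x)
      _ = w x * ‖u x‖ ^ 4 := by ring
  rw [setIntegral_const, hvol, smul_eq_mul] at h1
  have h2 := setIntegral_mono_set (μ := volume)
    (Continuous.integrableOn_Icc (f := fun x => w x * ‖u x‖ ^ 4) (by fun_prop))
    (ae_of_all _ fun x => mul_nonneg (w0 x) (by positivity)) hsub.eventuallyLE
  linarith

lemma energy_density_ge {lam m h z : ℝ} (hl : 1 ≤ lam) (hl2 : lam ≤ 2) (hm : 0 < m)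
    (h0 : 0 ≤ h) (hhm : h ≤ m) (z0 : 0 ≤ z) :
    5 / 8 * h ^ 2 - (3 * (lam - 1) ^ 2 + 2 * (m / 104857600) ^ 2)
      ≤ (lam * h ^ 2 + z - (lam - 1) * h
        - 1 / 81920 * (m / 1280 * h + z / (m / 1280)))
        + 1 / (32 * m) * ((1 - 1 / 81920) * z - (1 - lam + lam * h) ^ 2 * h) := by
  have hz : 0 ≤ z / m := by positivity
  have e1 : z / (m / 1280) = 1280 * (z / m) := by field_simp
  have e2 : 1 / (32 * m) * ((1 - 1 / 81920) * z - (1 - lam + lam * h) ^ 2 * h)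
      = 1 / 32 * (1 - 1 / 81920) * (z / m) - 1 / 32 * (1 - lam + lam * h) ^ 2 * (h / m) := by
    field_simp
  have hhm1 : h / m ≤ 1 := (div_le_one hm).mpr hhm
  have e3 : (1 - lam + lam * h) ^ 2 ≤ (lam - 1) ^ 2 + 4 * h ^ 2 := by
    have : 0 ≤ lam * h * (lam - 1) := by
      have : 0 ≤ lam - 1 := by linarith
      positivity
    nlinarith [mul_nonneg (by nlinarith : 0 ≤ 4 - lam ^ 2) (sq_nonneg h)]
  have e4 := mul_le_mul e3 hhm1 (by positivity) (by positivity)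
  rw [e1, e2]
  nlinarith [sq_nonneg (4 * (lam - 1) - h), sq_nonneg (h - 4 * (m / 104857600)),
    mul_nonneg (by linarith : 0 ≤ lam - 1) (sq_nonneg h)]

/-- Linear bound on `‖u‖²` near the critical field. -/
lemma norm_sq_le (hE : IsGLSolution lam u) (hl : 1 ≤ lam) (hl2 : lam ≤ 2) (hR : 0 < R)
    (hu : ContDiff ℝ (⊤ : ℕ∞) u) (pu : MagPeriodic R u) (x : ℝ × ℝ) :
    ‖u x‖ ^ 2 ≤ 10 ^ 8 * (lam - 1) := by
  have cu := hu.continuous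
  have ca := hu.annih.continuous
  have cc := hu.annih.creat.continuous
  obtain ⟨x₀, hmax⟩ := pu.norm_sq.exists_forall_le hR (by fun_prop)
  obtain ⟨m, hx₀⟩ : ∃ m, ‖u x₀‖ ^ 2 = m := ⟨_, rfl⟩
  rw [hx₀] at hmax
  refine (hmax x).trans ?_
  rcases (hx₀ ▸ sq_nonneg _ : 0 ≤ m).eq_or_lt with rfl | hm
  · nlinarith
  have hux : u x₀ ≠ 0 := by
    rintro h
    simp [h] at hx₀
    linarith
  obtain ⟨w, hw, hw4, hW⟩ := exists_slow_weight (δ := 1 / 81920) hR (by norm_num) (by norm_num) x₀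
  have cw := hw.contDiff.continuous
  have hY := hE.sq_le_setIntegral (by linarith) hl2 (pu.one_le hR hux) hu pu hmax hx₀ cw
    (fun x => (hw.pos x).le) hw4
  have hA := hE.setIntegral_energy hw (by norm_num) hR hu pu
    (by positivity : 0 < m / 1280) (x₀ - (R / 2, R / 2))
  have hB := setIntegral_creat hw (by norm_num) (by norm_num) hR hu.annih
    (pu.annih (hu.differentiable (by simp))) (x₀ - (R / 2, R / 2))
  set S := Icc (x₀ - (R / 2, R / 2)) (x₀ - (R / 2, R / 2) + (R, R)) with hS
  have hint : ∀ f : ℝ × ℝ → ℝ, Continuous f → IntegrableOn f S :=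
    fun f hf => hf.integrableOn_Icc
  have hC : 5 / 8 * (∫ x in S, w x * ‖u x‖ ^ 4)
      - (3 * (lam - 1) ^ 2 + 2 * (m / 104857600) ^ 2) * ∫ x in S, w x ≤ 0 := by
    refine le_trans ?_ (add_nonpos hA (mul_nonpos_of_nonneg_of_nonpos
      (by positivity : 0 ≤ 1 / (32 * m)) hB))
    rw [← integral_const_mul, ← integral_const_mul, ← integral_const_mul,
      ← integral_sub (hint _ (by fun_prop)) (hint _ (by fun_prop)),
      ← integral_add (hint _ (by fun_prop)) (hint _ (by fun_prop))]
    refine integral_mono (hint _ (by fun_prop)) (hint _ (by fun_prop)) fun y => ?_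
    have h1 := mul_le_mul_of_nonneg_left (energy_density_ge hl hl2 hm (sq_nonneg ‖u y‖) (hmax y)
      (sq_nonneg ‖annih u y‖)) (hw.pos y).le
    have h2 : ‖creat (annih u) y‖ ^ 2 = (1 - lam + lam * ‖u y‖ ^ 2) ^ 2 * ‖u y‖ ^ 2 := by
      rw [hE.creat_annih_eq hu, norm_mul, mul_pow, Complex.norm_real, Real.norm_eq_abs, sq_abs]
    simp only [h2]
    linear_combination h1
  have hD := mul_le_mul_of_nonneg_left hW
    (by positivity : 0 ≤ 3 * (lam - 1) ^ 2 + 2 * (m / 104857600) ^ 2)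
  refine abs_le_of_sq_le_sq' ?_ (by linarith) |>.2
  norm_num at hD
  nlinarith [sq_nonneg (lam - 1)]

end IsGLSolution

/-- Periodic minimizers solve the Ginzburg–Landau equation in all of `ℝ²` and satisfy a
universal `L∞` bound. -/
theorem stmt_13 :
    ∃ Cmax : ℝ, 0 < Cmax ∧
      ∀ b R : ℝ, 0 < b → 0 < R → ∀ u : ℝ × ℝ → ℂ,
        ContDiff ℝ (⊤ : ℕ∞) u → MagPeriodic R u → G2 b R u = mp b R →
        (∀ x : ℝ × ℝ,
          -(b : ℂ) * (D1 (fun y => D1 u y) x + D2 (fun y => D2 u y) x)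
            = (1 - (‖u x‖ : ℂ) ^ 2) * u x) ∧
        (∀ x : ℝ × ℝ,
          ‖u x‖ ≤ min 1 (Cmax * Real.sqrt (max (1 / b - 1) 0))) := by
  refine ⟨10000, by norm_num, fun b R hb hR u hu pu hmin => ?_⟩
  have hEL := euler_lagrange hb hR hu pu hmin
  refine ⟨hEL, fun x => ?_⟩
  have hb' : (b : ℂ) ≠ 0 := by exact_mod_cast hb.ne'
  have hE : IsGLSolution (1 / b) u := fun y => by
    have h := hEL y
    push_cast
    field_simp
    linear_combination -h
  have hl : 0 < 1 / b := by positivity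
  have h1 := hE.norm_le_one hl hR hu pu x
  refine le_min h1 ?_
  rcases le_total (1 / b) 1 with hlb | hlb
  · rw [hE.eq_zero_of_le_one hl hlb hR hu pu x, norm_zero]
    positivity
  rw [max_eq_left (by linarith)]
  have h2 : ‖u x‖ ^ 2 ≤ 10 ^ 8 * (1 / b - 1) := by
    rcases le_total (1 / b) 2 with hl2 | hl2
    · exact hE.norm_sq_le hlb hl2 hR hu pu x
    · nlinarith [norm_nonneg (u x)]
  refine abs_le_of_sq_le_sq' ?_ (by positivity) |>.2
  rw [mul_pow, Real.sq_sqrt (by linarith)]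
  linarith
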